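/- arXiv:2601.13908 — 9 statements merged into one kernel-verified Lean document; each statement's English description precedes it below -/
import Mathlib

section
/- If the matrix K is invertible, then Σ_{q=0}^{N} (K⁻¹)_{pq} φ_q(0) = 1 for every 0 ≤ p ≤ N, and Σ_{p=0}^{N} (K⁻¹)_{pq} φ_p(1) = 1 for every 0 ≤ q ≤ N. -/
open MeasureTheory Matrix Polynomial Topology Filter

/-- A Lagrange basis on `N + 1` distinct nodes is a partition of unity. -/
theorem sum_eq_one_of_lagrange_basis {N : ℕ} {τ : Fin (N + 1) → ℝ} (hτ : Function.Injective τ)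
    {φ : Fin (N + 1) → Polynomial ℝ} (hφdeg : ∀ p, (φ p).natDegree ≤ N)
    (hφeval : ∀ p q, (φ p).eval (τ q) = if p = q then 1 else 0) :
    ∑ p, φ p = 1 := by
  refine Polynomial.eq_of_natDegree_lt_card_of_eval_eq _ _ hτ (fun q => ?_) ?_
  · simp [Polynomial.eval_finsetSum, hφeval]
  · have h : (∑ p, φ p).natDegree ≤ N :=
      Polynomial.natDegree_sum_le_of_forall_le _ _ fun p _ => hφdeg p
    simp only [Polynomial.natDegree_one, Fintype.card_fin]
    omega

/-- The fundamental theorem of calculus for polynomials. -/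
theorem integral_eval_derivative (p : Polynomial ℝ) (a b : ℝ) :
    ∫ t in a..b, p.derivative.eval t = p.eval b - p.eval a :=
  intervalIntegral.integral_eq_sub_of_hasDerivAt (fun t _ => p.hasDerivAt t)
    (p.derivative.continuous.intervalIntegrable a b)

/-- Weighted row/column sums of `K⁻¹` against `φ(0)` resp. `φ(1)` equal `1`. -/
theorem aderdg_Kinv_sums
    (N : ℕ) (hN : 1 ≤ N)
    (τ : Fin (N + 1) → ℝ) (hτ : StrictMono τ)
    (hτmem : ∀ k, τ k ∈ Set.Ioo (0 : ℝ) 1)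
    (horth : ∀ j : ℕ, j ≤ N →
      ∫ ξ in (0:ℝ)..1, ξ ^ j * ∏ k, (ξ - τ k) = 0)
    (φ : Fin (N + 1) → Polynomial ℝ)
    (hφdeg : ∀ p, (φ p).natDegree ≤ N)
    (hφeval : ∀ p q, (φ p).eval (τ q) = if p = q then 1 else 0)
    (K : Matrix (Fin (N + 1)) (Fin (N + 1)) ℝ)
    (hK : ∀ p q, K p q = (φ p).eval 0 * (φ q).eval 0 +
      ∫ t in (0:ℝ)..1, (φ p).eval t * (φ q).derivative.eval t)
    (hKdet : IsUnit K.det) :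
    (∀ p, ∑ q, K⁻¹ p q * (φ q).eval 0 = 1) ∧
      (∀ q, ∑ p, K⁻¹ p q * (φ p).eval 1 = 1) := by
  have hsum := sum_eq_one_of_lagrange_basis hτ.injective hφdeg hφeval
  have heval : ∀ t : ℝ, ∑ p, (φ p).eval t = 1 := fun t => by
    rw [← Polynomial.eval_finsetSum, hsum, Polynomial.eval_one]
  have hderiv : ∀ t : ℝ, ∑ p, (φ p).derivative.eval t = 0 := fun t => by
    rw [← Polynomial.eval_finsetSum, ← Polynomial.derivative_sum, hsum,
      Polynomial.derivative_one, Polynomial.eval_zero]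
  have hintegrable : ∀ p q, IntervalIntegrable
      (fun t => (φ p).eval t * (φ q).derivative.eval t) volume 0 1 := fun p q =>
    ((φ p).continuous.mul (φ q).derivative.continuous).intervalIntegrable 0 1
  have hrow : (K *ᵥ fun _ => (1 : ℝ)) = fun p => (φ p).eval 0 := by
    funext p
    simp only [Matrix.mulVec, dotProduct, mul_one, hK, Finset.sum_add_distrib]
    rw [← intervalIntegral.integral_finsetSum fun q _ => hintegrable p q]
    simp only [← Finset.mul_sum, heval, hderiv, mul_one, mul_zero,
      intervalIntegral.integral_zero, add_zero]
  have hcol : ((fun _ => (1 : ℝ)) ᵥ* K) = fun q => (φ q).eval 1 := by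
    funext q
    simp only [Matrix.vecMul, dotProduct, one_mul, hK, Finset.sum_add_distrib]
    rw [← intervalIntegral.integral_finsetSum fun p _ => hintegrable p q]
    simp only [← Finset.sum_mul, heval, one_mul, integral_eval_derivative]
    ring
  constructor
  · intro p
    have h : (K⁻¹ *ᵥ fun q => (φ q).eval 0) p = 1 := by
      rw [← hrow, Matrix.mulVec_mulVec, Matrix.nonsing_inv_mul K hKdet, Matrix.one_mulVec]
    exact h
  · intro q
    have h : ((fun p => (φ p).eval 1) ᵥ* K⁻¹) q = 1 := by
      rw [← hcol, Matrix.vecMul_vecMul, Matrix.mul_nonsing_inv K hKdet, Matrix.vecMul_one]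
    simpa only [Matrix.vecMul, dotProduct, mul_comm] using h
end

section
/- For every integer k with 0 ≤ k ≤ N−1 and every index 0 ≤ p ≤ N, the matrix K reproduces integration of power functions at the nodes: Σ_{q=0}^{N} K_{pq} · τ_q^{k+1}/(k+1) = w_p · τ_p^{k}. -/
open MeasureTheory Matrix Polynomial Topology Filter

/-- If all moments of the polynomial `P` up to order `n` vanish on `[0, 1]`, then `P` is orthogonal
to every polynomial of degree at most `n`. -/
theorem integral_eval_mul_eq_zero_of_moments (n : ℕ) (P g : Polynomial ℝ) (hg : g.natDegree ≤ n)
    (hP : ∀ j : ℕ, j ≤ n → ∫ ξ in (0:ℝ)..1, ξ ^ j * P.eval ξ = 0) :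
    ∫ t in (0:ℝ)..1, (P * g).eval t = 0 := by
  have h : ∀ t : ℝ, (P * g).eval t =
      ∑ j ∈ Finset.range (n + 1), g.coeff j * (t ^ j * P.eval t) := by
    intro t
    rw [eval_mul, eval_eq_sum_range' (Nat.lt_succ_of_le hg), Finset.mul_sum]
    exact Finset.sum_congr rfl fun j _ => by ring
  simp_rw [h]
  rw [intervalIntegral.integral_finsetSum
    fun j _ => Continuous.intervalIntegrable (by fun_prop) _ _]
  refine Finset.sum_eq_zero fun j hj => ?_
  rw [intervalIntegral.integral_const_mul, hP j (Nat.lt_succ_iff.1 (Finset.mem_range.1 hj)),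
    mul_zero]

/-- The integral over `[0, 1]` of a polynomial of degree at most `2 * N + 1` vanishing at the
Gauss-Legendre nodes is zero. -/
theorem integral_eval_eq_zero_of_eval_nodes (N : ℕ) (τ : Fin (N + 1) → ℝ)
    (hτ : Function.Injective τ)
    (horth : ∀ j : ℕ, j ≤ N → ∫ ξ in (0:ℝ)..1, ξ ^ j * ∏ k, (ξ - τ k) = 0)
    (f : Polynomial ℝ) (hdeg : f.natDegree ≤ 2 * N + 1) (hf : ∀ q, f.eval (τ q) = 0) :
    ∫ t in (0:ℝ)..1, f.eval t = 0 := by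
  obtain ⟨g, rfl⟩ : Lagrange.nodal Finset.univ τ ∣ f := by
    rw [Lagrange.nodal]
    exact Finset.prod_dvd_of_coprime
      (fun i _ j _ hij => pairwise_coprime_X_sub_C hτ hij)
      fun i _ => dvd_iff_isRoot.2 (hf i)
  refine integral_eval_mul_eq_zero_of_moments N _ g ?_
    fun j hj => by simpa only [Lagrange.eval_nodal] using horth j hj
  by_cases hg : g = 0
  · simp [hg]
  · rw [natDegree_mul Lagrange.nodal_ne_zero hg, Lagrange.natDegree_nodal, Finset.card_univ,
      Fintype.card_fin] at hdeg
    omega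

/-- A polynomial of degree at most `N` is the combination of the Lagrange basis polynomials with
its nodal values as coefficients. -/
theorem sum_C_eval_mul_lagrange_basis (N : ℕ) (τ : Fin (N + 1) → ℝ) (hτ : Function.Injective τ)
    (φ : Fin (N + 1) → Polynomial ℝ) (hφdeg : ∀ p, (φ p).natDegree ≤ N)
    (hφeval : ∀ p q, (φ p).eval (τ q) = if p = q then 1 else 0)
    (f : Polynomial ℝ) (hf : f.natDegree ≤ N) :
    ∑ q, C (f.eval (τ q)) * φ q = f := by
  have hlt : ∀ g : Polynomial ℝ, g.natDegree ≤ N →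
      g.degree < (Finset.univ : Finset (Fin (N + 1))).card := by
    intro g hg
    rw [Finset.card_univ, Fintype.card_fin]
    exact lt_of_le_of_lt (degree_le_of_natDegree_le hg) (by exact_mod_cast Nat.lt_succ_self N)
  refine Polynomial.eq_of_degrees_lt_of_eval_index_eq Finset.univ hτ.injOn
    (hlt _ ?_) (hlt _ hf) fun i _ => ?_
  · exact natDegree_sum_le_of_forall_le _ _ fun q _ => (natDegree_C_mul_le _ _).trans (hφdeg q)
  · simp [eval_finsetSum, hφeval]

/-- The matrix `K` reproduces integration of power functions at the nodes. -/
theorem aderdg_K_integrates_powers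
    (N : ℕ) (hN : 1 ≤ N)
    (τ : Fin (N + 1) → ℝ) (hτ : StrictMono τ)
    (hτmem : ∀ k, τ k ∈ Set.Ioo (0 : ℝ) 1)
    (horth : ∀ j : ℕ, j ≤ N →
      ∫ ξ in (0:ℝ)..1, ξ ^ j * ∏ k, (ξ - τ k) = 0)
    (φ : Fin (N + 1) → Polynomial ℝ)
    (hφdeg : ∀ p, (φ p).natDegree ≤ N)
    (hφeval : ∀ p q, (φ p).eval (τ q) = if p = q then 1 else 0)
    (w : Fin (N + 1) → ℝ)
    (hw : ∀ p, w p = ∫ t in (0:ℝ)..1, (φ p).eval t)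
    (K : Matrix (Fin (N + 1)) (Fin (N + 1)) ℝ)
    (hK : ∀ p q, K p q = (φ p).eval 0 * (φ q).eval 0 +
      ∫ t in (0:ℝ)..1, (φ p).eval t * (φ q).derivative.eval t)
    :
    ∀ k : ℕ, k ≤ N - 1 → ∀ p,
      ∑ q, K p q * (τ q) ^ (k + 1) / ((k : ℝ) + 1) = w p * (τ p) ^ k := by
  intro k hk p
  have hk0 : ((k : ℝ) + 1) ≠ 0 := by positivity
  have hsum := sum_C_eval_mul_lagrange_basis N τ hτ.injective φ hφdeg hφeval
    (X ^ (k + 1)) (by rw [natDegree_X_pow]; omega)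
  simp only [eval_pow, eval_X] at hsum
  have h0 : ∑ q, τ q ^ (k + 1) * (φ q).eval 0 = 0 := by
    simpa [eval_finsetSum] using congrArg (eval 0) hsum
  have hd : ∀ t : ℝ, ∑ q, τ q ^ (k + 1) * (φ q).derivative.eval t = ((k : ℝ) + 1) * t ^ k := by
    intro t
    simpa [eval_finsetSum, derivative_sum, derivative_pow] using
      congrArg (fun f => eval t (derivative f)) hsum
  have hint : ∑ q, τ q ^ (k + 1) * ∫ t in (0:ℝ)..1, (φ p).eval t * (φ q).derivative.eval t =
      ((k : ℝ) + 1) * ∫ t in (0:ℝ)..1, (φ p).eval t * t ^ k := by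
    simp_rw [← intervalIntegral.integral_const_mul]
    rw [← intervalIntegral.integral_finsetSum
      fun q _ => Continuous.intervalIntegrable (by fun_prop) _ _]
    congr 1
    ext t
    rw [mul_left_comm, ← hd t, Finset.mul_sum]
    exact Finset.sum_congr rfl fun q _ => by ring
  have hquad : ∫ t in (0:ℝ)..1, (φ p * (X ^ k - C (τ p ^ k))).eval t = 0 := by
    refine integral_eval_eq_zero_of_eval_nodes N τ hτ.injective horth _ ?_ fun q => ?_
    · refine natDegree_mul_le.trans ?_
      rw [natDegree_X_pow_sub_C]
      have := hφdeg p
      omega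
    · rw [eval_mul, hφeval]
      split_ifs with h
      · simp [h]
      · simp
  simp only [eval_mul, eval_sub, eval_pow, eval_X, eval_C, mul_sub] at hquad
  rw [intervalIntegral.integral_sub (Continuous.intervalIntegrable (by fun_prop) _ _)
    (Continuous.intervalIntegrable (by fun_prop) _ _), intervalIntegral.integral_mul_const,
    ← hw p, sub_eq_zero] at hquad
  rw [← Finset.sum_div, div_eq_iff hk0, ← hquad, mul_comm _ ((k : ℝ) + 1), ← hint]
  calc ∑ q, K p q * τ q ^ (k + 1)
      = (φ p).eval 0 * ∑ q, τ q ^ (k + 1) * (φ q).eval 0 +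
        ∑ q, τ q ^ (k + 1) * ∫ t in (0:ℝ)..1, (φ p).eval t * (φ q).derivative.eval t := by
        rw [Finset.mul_sum, ← Finset.sum_add_distrib]
        exact Finset.sum_congr rfl fun q _ => by rw [hK]; ring
    _ = _ := by rw [h0, mul_zero, zero_add]
end

section
/- Assume the matrix K is invertible and set A = K⁻¹M. Then for every integer k with 0 ≤ k ≤ N−1 and every τ ∈ [0,1], the integral of the power function is exactly represented in the Lagrange basis through the matrix A: ∫_0^τ ξ^k dξ = τ^{k+1}/(k+1) = Σ_{p=0}^{N} Σ_{q=0}^{N} φ_p(τ) · A_{pq} · τ_q^{k}. -/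
open MeasureTheory Matrix Polynomial Topology Filter

/-- A polynomial of degree at most `N` is the sum of its nodal values times the nodal basis. -/
lemma eq_sum_nodal_values {N : ℕ} {τ : Fin (N + 1) → ℝ} (hτ : Function.Injective τ)
    {φ : Fin (N + 1) → ℝ[X]} (hφdeg : ∀ p, (φ p).natDegree ≤ N)
    (hφeval : ∀ p q, (φ p).eval (τ q) = if p = q then 1 else 0)
    {f : ℝ[X]} (hf : f.natDegree ≤ N) :
    f = ∑ p, C (f.eval (τ p)) * φ p := by
  have hlt : ∀ g : ℝ[X], g.natDegree ≤ N → g.degree < (Finset.univ : Finset (Fin (N + 1))).card := by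
    intro g hg
    rw [Finset.card_univ, Fintype.card_fin]
    exact lt_of_le_of_lt (natDegree_le_iff_degree_le.mp hg) (by exact_mod_cast Nat.lt_succ_self N)
  refine eq_of_degrees_lt_of_eval_index_eq Finset.univ hτ.injOn (hlt f hf) (hlt _ ?_) ?_
  · exact natDegree_sum_le_of_forall_le _ _ fun p _ =>
      (natDegree_C_mul_le _ _).trans (hφdeg p)
  · intro q _
    simp [eval_finsetSum, hφeval]

/-- Gauss quadrature error term: a polynomial of degree at most `2N + 1` vanishing at all the
Gauss nodes has zero integral. -/
lemma integral_eq_zero_of_eval_nodes_eq_zero {N : ℕ} {τ : Fin (N + 1) → ℝ}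
    (hτ : Function.Injective τ)
    (horth : ∀ j : ℕ, j ≤ N → ∫ ξ in (0:ℝ)..1, ξ ^ j * ∏ k, (ξ - τ k) = 0)
    {f : ℝ[X]} (hf : f.natDegree ≤ 2 * N + 1) (hzero : ∀ k, f.eval (τ k) = 0) :
    ∫ t in (0:ℝ)..1, f.eval t = 0 := by
  have hdvd : (∏ k, (X - C (τ k))) ∣ f :=
    Finset.prod_dvd_of_coprime
      (fun a _ b _ hab => pairwise_coprime_X_sub_C hτ hab)
      (fun k _ => dvd_iff_isRoot.mpr (hzero k))
  obtain ⟨g, rfl⟩ := hdvd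
  have hmonic : (∏ k, (X - C (τ k))).Monic := monic_prod_X_sub_C _ _
  rcases eq_or_ne g 0 with rfl | hg
  · simp
  have hgdeg : g.natDegree < N + 1 := by
    rw [hmonic.natDegree_mul' hg, natDegree_finsetProd_X_sub_C_eq_card] at hf
    simp at hf
    omega
  have hexp : ∀ t : ℝ, ((∏ k, (X - C (τ k))) * g).eval t =
      ∑ j ∈ Finset.range (N + 1), g.coeff j * (t ^ j * ∏ k, (t - τ k)) := by
    intro t
    rw [eval_mul, eval_eq_sum_range' hgdeg, eval_prod, Finset.mul_sum]
    refine Finset.sum_congr rfl fun j _ => ?_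
    simp only [eval_sub, eval_X, eval_C]
    ring
  simp_rw [hexp]
  rw [intervalIntegral.integral_finsetSum
    fun j _ => Continuous.intervalIntegrable (by fun_prop) _ _]
  refine Finset.sum_eq_zero fun j hj => ?_
  rw [intervalIntegral.integral_const_mul, horth j (Nat.lt_succ_iff.mp (Finset.mem_range.mp hj)),
    mul_zero]

/-- The integral of a power function is exactly represented in the Lagrange basis
through the ADER matrix `A = K⁻¹M`. -/
theorem aderdg_power_integral_representation
    (N : ℕ) (hN : 1 ≤ N)
    (τ : Fin (N + 1) → ℝ) (hτ : StrictMono τ)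
    (hτmem : ∀ k, τ k ∈ Set.Ioo (0 : ℝ) 1)
    (horth : ∀ j : ℕ, j ≤ N →
      ∫ ξ in (0:ℝ)..1, ξ ^ j * ∏ k, (ξ - τ k) = 0)
    (φ : Fin (N + 1) → Polynomial ℝ)
    (hφdeg : ∀ p, (φ p).natDegree ≤ N)
    (hφeval : ∀ p q, (φ p).eval (τ q) = if p = q then 1 else 0)
    (w : Fin (N + 1) → ℝ)
    (hw : ∀ p, w p = ∫ t in (0:ℝ)..1, (φ p).eval t)
    (K : Matrix (Fin (N + 1)) (Fin (N + 1)) ℝ)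
    (hK : ∀ p q, K p q = (φ p).eval 0 * (φ q).eval 0 +
      ∫ t in (0:ℝ)..1, (φ p).eval t * (φ q).derivative.eval t)
    (hKdet : IsUnit K.det)
    (A : Matrix (Fin (N + 1)) (Fin (N + 1)) ℝ)
    (hA : A = K⁻¹ * Matrix.diagonal w)
    :
    ∀ k : ℕ, k ≤ N - 1 → ∀ t ∈ Set.Icc (0:ℝ) 1,
      (∫ ξ in (0:ℝ)..t, ξ ^ k) = t ^ (k + 1) / ((k : ℝ) + 1) ∧
        t ^ (k + 1) / ((k : ℝ) + 1) =
          ∑ p, ∑ q, (φ p).eval t * A p q * (τ q) ^ k := by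
  intro k hk t _
  have hk1 : k + 1 ≤ N := by omega
  have hk0 : (k : ℝ) + 1 ≠ 0 := by positivity
  refine ⟨by simp [integral_pow], ?_⟩
  set f : ℝ[X] := C (((k : ℝ) + 1)⁻¹) * X ^ (k + 1) with hf
  have hfeval : ∀ x, f.eval x = x ^ (k + 1) / ((k : ℝ) + 1) := fun x => by
    simp [hf, div_eq_inv_mul]
  have hfder : f.derivative = X ^ k := by
    rw [hf, derivative_C_mul_X_pow, Nat.add_sub_cancel, Nat.cast_add_one,
      inv_mul_cancel₀ hk0, C_1, one_mul]
  have hfsum := eq_sum_nodal_values hτ.injective hφdeg hφeval (f := f)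
    ((natDegree_C_mul_X_pow_le _ _).trans hk1)
  have hquad : ∀ p, ∫ x in (0:ℝ)..1, (φ p).eval x * x ^ k = w p * τ p ^ k := by
    intro p
    have h := integral_eq_zero_of_eval_nodes_eq_zero hτ.injective horth
      (f := φ p * (X ^ k - C (τ p ^ k)))
      (natDegree_mul_le.trans (by
        have h1 := hφdeg p
        have h2 : (X ^ k - C (τ p ^ k) : ℝ[X]).natDegree ≤ k := natDegree_X_pow_sub_C.le
        omega))
      (fun q => by
        rw [eval_mul, hφeval]
        split_ifs with hpq
        · simp [hpq]
        · simp)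
    simp only [eval_mul, eval_sub, eval_pow, eval_X, eval_C, mul_sub] at h
    rw [intervalIntegral.integral_sub (Continuous.intervalIntegrable (by fun_prop) _ _)
      (Continuous.intervalIntegrable (by fun_prop) _ _), intervalIntegral.integral_mul_const,
      ← hw] at h
    linarith
  have hKr : K *ᵥ (fun q => f.eval (τ q)) = Matrix.diagonal w *ᵥ fun q => τ q ^ k := by
    ext p
    rw [mulVec_diagonal, ← hquad p]
    have h0 : ∑ q, f.eval (τ q) * (φ q).eval 0 = 0 := by
      have h := congrArg (eval 0) hfsum
      simp only [eval_finsetSum, eval_mul, eval_C] at h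
      rw [← h, hfeval]
      simp
    have hint : ∑ q, (∫ x in (0:ℝ)..1, (φ p).eval x * (φ q).derivative.eval x) * f.eval (τ q) =
        ∫ x in (0:ℝ)..1, (φ p).eval x * x ^ k := by
      simp_rw [← intervalIntegral.integral_mul_const]
      rw [← intervalIntegral.integral_finsetSum
        fun q _ => Continuous.intervalIntegrable (by fun_prop) _ _]
      congr 1
      ext x
      have h := congrArg (fun g => (derivative g).eval x) hfsum
      simp only [hfder, derivative_sum, derivative_C_mul, eval_finsetSum, eval_mul, eval_C,
        eval_pow, eval_X] at h
      rw [h, Finset.mul_sum]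
      exact Finset.sum_congr rfl fun q _ => by ring
    rw [← hint]
    simp only [mulVec, dotProduct, hK, add_mul, Finset.sum_add_distrib]
    rw [add_eq_right]
    have h := congrArg ((φ p).eval 0 * ·) h0
    simp only [mul_zero, Finset.mul_sum] at h
    refine Eq.trans ?_ h
    exact Finset.sum_congr rfl fun q _ => by ring
  have hAr : A *ᵥ (fun q => τ q ^ k) = fun q => f.eval (τ q) := by
    rw [hA, ← mulVec_mulVec, ← hKr, mulVec_mulVec, nonsing_inv_mul _ hKdet, one_mulVec]
  have h := congrArg (eval t) hfsum
  simp only [eval_finsetSum, eval_mul, eval_C] at h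
  rw [← hfeval, h]
  refine Finset.sum_congr rfl fun p _ => ?_
  rw [← congrFun hAr p, mulVec, dotProduct, Finset.sum_mul]
  exact Finset.sum_congr rfl fun q _ => by ring
end

section
/- Assume the matrix K is invertible and set A = K⁻¹M. Let D ≥ 1 be an integer, u_n ∈ ℝ^D, Δt ∈ ℝ, and let F_0, …, F_N ∈ ℝ^D be arbitrary vectors. If the vectors q̂_0, …, q̂_N ∈ ℝ^D satisfy q̂_p = u_n + Δt · Σ_{q=0}^{N} A_{pq} F_q for every 0 ≤ p ≤ N, then the local solution evaluated at the left endpoint τ = 0 satisfies Σ_{p=0}^{N} φ_p(0) · q̂_p = u_n + Δt · Σ_{q=0}^{N} w̃_q F_q, where w̃_q = w_q · Σ_{r=0}^{N} (K⁻¹)_{rq} φ_r(0); moreover the vector (w̃_0, …, w̃_N) is nonzero. -/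
open MeasureTheory Matrix Polynomial Topology Filter

/-- The product of the node factors divides every polynomial vanishing at the distinct nodes. -/
theorem prod_X_sub_C_dvd_of_eval_eq_zero {ι : Type*} [Fintype ι] {τ : ι → ℝ}
    (hτ : Function.Injective τ) {P : ℝ[X]} (hP : ∀ k, P.eval (τ k) = 0) :
    (∏ k, (X - C (τ k))) ∣ P :=
  Finset.prod_dvd_of_coprime (fun _ _ _ _ hij => pairwise_coprime_X_sub_C hτ hij)
    (fun k _ => dvd_iff_isRoot.mpr (hP k))

/-- If the node polynomial is orthogonal to all monomials of degree at most `N`, its product with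
any polynomial of degree at most `N` has integral zero. -/
theorem integral_eval_mul_prod_eq_zero {ι : Type*} [Fintype ι] {τ : ι → ℝ} {N : ℕ}
    (horth : ∀ j : ℕ, j ≤ N → ∫ ξ in (0:ℝ)..1, ξ ^ j * ∏ k, (ξ - τ k) = 0)
    {Q : ℝ[X]} (hQ : Q.natDegree ≤ N) :
    ∫ ξ in (0:ℝ)..1, Q.eval ξ * ∏ k, (ξ - τ k) = 0 := by
  have hsum : ∀ ξ : ℝ, Q.eval ξ * ∏ k, (ξ - τ k) =
      ∑ j ∈ Finset.range (N + 1), Q.coeff j * (ξ ^ j * ∏ k, (ξ - τ k)) := by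
    intro ξ
    rw [eval_eq_sum_range' (Nat.lt_succ_of_le hQ), Finset.sum_mul]
    simp only [mul_assoc]
  simp_rw [hsum]
  rw [intervalIntegral.integral_finsetSum]
  · refine Finset.sum_eq_zero fun j hj => ?_
    rw [intervalIntegral.integral_const_mul,
      horth j (Nat.lt_succ_iff.mp (Finset.mem_range.mp hj)), mul_zero]
  · intro j _
    exact Continuous.intervalIntegrable (by fun_prop) _ _

/-- Gauss quadrature: a polynomial of degree at most `2 * N + 1` that vanishes at all nodes
has integral zero. -/
theorem integral_eval_eq_zero_of_eval_nodes_eq_zero {N : ℕ} {τ : Fin (N + 1) → ℝ}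
    (hτ : Function.Injective τ)
    (horth : ∀ j : ℕ, j ≤ N → ∫ ξ in (0:ℝ)..1, ξ ^ j * ∏ k, (ξ - τ k) = 0)
    {P : ℝ[X]} (hdeg : P.natDegree ≤ 2 * N + 1) (hP : ∀ k, P.eval (τ k) = 0) :
    ∫ t in (0:ℝ)..1, P.eval t = 0 := by
  obtain ⟨Q, rfl⟩ := prod_X_sub_C_dvd_of_eval_eq_zero hτ hP
  have hmonic : (∏ k, (X - C (τ k))).Monic := monic_prod_X_sub_C τ Finset.univ
  have hQ : Q.natDegree ≤ N := by
    rcases eq_or_ne Q 0 with rfl | hQ0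
    · simp
    · rw [hmonic.natDegree_mul' hQ0, natDegree_finsetProd_X_sub_C_eq_card] at hdeg
      simp only [Finset.card_univ, Fintype.card_fin] at hdeg
      omega
  simpa [eval_prod, mul_comm] using integral_eval_mul_prod_eq_zero horth hQ

/-- The Gauss quadrature weights are positive. -/
theorem integral_lagrangeBasis_pos {N : ℕ} {τ : Fin (N + 1) → ℝ}
    (hτ : Function.Injective τ) (hτmem : ∀ k, τ k ∈ Set.Ioo (0 : ℝ) 1)
    (horth : ∀ j : ℕ, j ≤ N → ∫ ξ in (0:ℝ)..1, ξ ^ j * ∏ k, (ξ - τ k) = 0)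
    {p : Fin (N + 1)} {f : ℝ[X]} (hdeg : f.natDegree ≤ N)
    (heval : ∀ q, f.eval (τ q) = if p = q then 1 else 0) :
    0 < ∫ t in (0:ℝ)..1, f.eval t := by
  have hsq : ∫ t in (0:ℝ)..1, (f ^ 2 - f).eval t = 0 := by
    refine integral_eval_eq_zero_of_eval_nodes_eq_zero hτ horth ?_ fun k => ?_
    · refine (natDegree_sub_le _ _).trans (max_le (natDegree_pow_le.trans ?_) ?_) <;> omega
    · rw [eval_sub, eval_pow, heval]
      split_ifs <;> norm_num
  simp only [eval_sub, eval_pow] at hsq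
  rw [intervalIntegral.integral_sub (Continuous.intervalIntegrable (by fun_prop) _ _)
    (Continuous.intervalIntegrable (by fun_prop) _ _), sub_eq_zero] at hsq
  rw [← hsq]
  refine intervalIntegral.integral_pos one_pos (by fun_prop) (fun _ _ => sq_nonneg _)
    ⟨τ p, Set.Ioo_subset_Icc_self (hτmem p), ?_⟩
  simp [heval]

/-- The Lagrange basis polynomials sum to one. -/
theorem sum_lagrangeBasis_eq_one {N : ℕ} {τ : Fin (N + 1) → ℝ} (hτ : Function.Injective τ)
    {φ : Fin (N + 1) → ℝ[X]} (hdeg : ∀ p, (φ p).natDegree ≤ N)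
    (heval : ∀ p q, (φ p).eval (τ q) = if p = q then 1 else 0) :
    ∑ p, φ p = 1 := by
  have hlt : ∀ P : ℝ[X], P.natDegree ≤ N →
      P.degree < (Finset.univ : Finset (Fin (N + 1))).card := by
    intro P hP
    rw [Finset.card_univ, Fintype.card_fin]
    exact (natDegree_le_iff_degree_le.mp hP).trans_lt (by exact_mod_cast Nat.lt_succ_self N)
  refine eq_of_degrees_lt_of_eval_index_eq Finset.univ hτ.injOn
    (hlt _ (natDegree_sum_le_of_forall_le _ _ fun p _ => hdeg p)) (hlt _ (by simp)) fun q _ => ?_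
  simp [eval_finsetSum, heval]

/-- The local DG predictor solution evaluated at `τ = 0` is a nontrivially
weighted node update. -/
theorem aderdg_local_solution_left_endpoint
    (N : ℕ) (hN : 1 ≤ N)
    (τ : Fin (N + 1) → ℝ) (hτ : StrictMono τ)
    (hτmem : ∀ k, τ k ∈ Set.Ioo (0 : ℝ) 1)
    (horth : ∀ j : ℕ, j ≤ N →
      ∫ ξ in (0:ℝ)..1, ξ ^ j * ∏ k, (ξ - τ k) = 0)
    (φ : Fin (N + 1) → Polynomial ℝ)
    (hφdeg : ∀ p, (φ p).natDegree ≤ N)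
    (hφeval : ∀ p q, (φ p).eval (τ q) = if p = q then 1 else 0)
    (w : Fin (N + 1) → ℝ)
    (hw : ∀ p, w p = ∫ t in (0:ℝ)..1, (φ p).eval t)
    (K : Matrix (Fin (N + 1)) (Fin (N + 1)) ℝ)
    (hK : ∀ p q, K p q = (φ p).eval 0 * (φ q).eval 0 +
      ∫ t in (0:ℝ)..1, (φ p).eval t * (φ q).derivative.eval t)
    (hKdet : IsUnit K.det)
    (A : Matrix (Fin (N + 1)) (Fin (N + 1)) ℝ)
    (hA : A = K⁻¹ * Matrix.diagonal w)
    (D : ℕ) (hD : 1 ≤ D)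
    (un : Fin D → ℝ) (Δt : ℝ)
    (Fv : Fin (N + 1) → Fin D → ℝ)
    (qh : Fin (N + 1) → Fin D → ℝ)
    (hqh : ∀ p, qh p = un + Δt • ∑ q, A p q • Fv q)
    (wt : Fin (N + 1) → ℝ)
    (hwt : ∀ q, wt q = w q * ∑ r, K⁻¹ r q * (φ r).eval 0) :
    (∑ p, (φ p).eval 0 • qh p = un + Δt • ∑ q, wt q • Fv q) ∧ wt ≠ 0 := by
  have hsum : ∑ p, (φ p).eval 0 = 1 := by
    rw [← eval_finsetSum, sum_lagrangeBasis_eq_one hτ.injective hφdeg hφeval, eval_one]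
  constructor
  · have hwtA : ∀ q, wt q = ∑ p, (φ p).eval 0 * A p q := by
      intro q
      rw [hwt, hA, Finset.mul_sum]
      refine Finset.sum_congr rfl fun p _ => ?_
      rw [mul_diagonal]
      ring
    simp_rw [hqh, smul_add, Finset.sum_add_distrib, ← Finset.sum_smul, hsum, one_smul, hwtA,
      Finset.sum_smul, smul_comm _ Δt, ← Finset.smul_sum, Finset.smul_sum (N := Fin D → ℝ),
      smul_smul]
    rw [Finset.sum_comm]
  · intro h0
    have hv : (fun r => (φ r).eval 0) ᵥ* K⁻¹ = 0 := by
      ext q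
      have hq := hwt q
      rw [h0, Pi.zero_apply, eq_comm, mul_eq_zero] at hq
      have hwq : w q ≠ 0 := by
        rw [hw]
        exact (integral_lagrangeBasis_pos hτ.injective hτmem horth (hφdeg q) (hφeval q)).ne'
      simpa [vecMul, dotProduct, mul_comm] using hq.resolve_left hwq
    have hφ0 : (fun r => (φ r).eval 0) = 0 := by
      rw [← vecMul_one (fun r => (φ r).eval 0), ← nonsing_inv_mul K hKdet, ← vecMul_vecMul, hv,
        zero_vecMul]
    simp [fun r => congrFun hφ0 r] at hsum
end

section
/- Continuity of the improved local solution: let D ≥ 1 and M ≥ 1 be integers, let t_0 < t_1 < … < t_M be real numbers with Δt_n = t_{n+1} − t_n, let F : ℝ^D × ℝ → ℝ^D be any function, let u_0 ∈ ℝ^D, and for each 0 ≤ n < M and 0 ≤ p ≤ N let q̂_{n,p} ∈ ℝ^D be arbitrary vectors. Define node values recursively by u_{n+1} = u_n + Δt_n · Σ_{p=0}^{N} w_p F(q̂_{n,p}, t_n + τ_p Δt_n), and define u_IL : [t_0, t_M] → ℝ^D piecewise by u_IL(t) = u_n + Δt_n · Σ_{p=0}^{N} F(q̂_{n,p}, t_n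 + τ_p Δt_n) · ∫_0^{(t − t_n)/Δt_n} φ_p(ξ) dξ for t ∈ [t_n, t_{n+1}) (and by the n = M−1 formula at t = t_M). Then u_IL is continuous on [t_0, t_M] and u_IL(t_n) = u_n for every 0 ≤ n ≤ M; in particular the piecewise formulas for consecutive intervals agree at every interior grid node. -/
open MeasureTheory Matrix Polynomial Topology Filter

/-- A function that is continuous on each cell of a finite grid is continuous on the whole range of
the grid. -/
theorem continuousOn_Icc_of_grid {α X : Type*} [LinearOrder α] [TopologicalSpace α]
    [OrderClosedTopology α] [TopologicalSpace X] {f : α → X} {t : ℕ → α} {M : ℕ}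
    (ht : ∀ n < M, t n ≤ t (n + 1))
    (hf : ∀ n < M, ContinuousOn f (Set.Icc (t n) (t (n + 1)))) :
    ContinuousOn f (Set.Icc (t 0) (t M)) := by
  have key : ∀ n ≤ M, t 0 ≤ t n ∧ ContinuousOn f (Set.Icc (t 0) (t n)) := by
    intro n
    induction n with
    | zero => simp
    | succ n ih =>
      intro hn
      obtain ⟨hle, hcont⟩ := ih (by lia)
      refine ⟨hle.trans (ht n hn), ?_⟩
      rw [← Set.Icc_union_Icc_eq_Icc hle (ht n hn)]
      exact hcont.union_of_isClosed (hf n hn) isClosed_Icc isClosed_Icc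
  exact (key M le_rfl).2

/-- Continuity of the improved local solution of the ADER-DG method: it is
continuous on the whole grid and matches the node values at every grid node. -/
theorem aderdg_improved_local_solution_continuous
    (N : ℕ) (hN : 1 ≤ N)
    (τ : Fin (N + 1) → ℝ) (hτ : StrictMono τ)
    (hτmem : ∀ k, τ k ∈ Set.Ioo (0 : ℝ) 1)
    (horth : ∀ j : ℕ, j ≤ N →
      ∫ ξ in (0:ℝ)..1, ξ ^ j * ∏ k, (ξ - τ k) = 0)
    (φ : Fin (N + 1) → Polynomial ℝ)
    (hφdeg : ∀ p, (φ p).natDegree ≤ N)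
    (hφeval : ∀ p q, (φ p).eval (τ q) = if p = q then 1 else 0)
    (w : Fin (N + 1) → ℝ)
    (hw : ∀ p, w p = ∫ t in (0:ℝ)..1, (φ p).eval t)
    (D : ℕ) (hD : 1 ≤ D) (M : ℕ) (hM : 1 ≤ M)
    (t : ℕ → ℝ) (ht : ∀ n < M, t n < t (n + 1))
    (F : (Fin D → ℝ) → ℝ → (Fin D → ℝ))
    (u : ℕ → Fin D → ℝ)
    (qh : ℕ → Fin (N + 1) → Fin D → ℝ)
    (hu : ∀ n < M, u (n + 1) = u n + (t (n + 1) - t n) •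
      ∑ p, w p • F (qh n p) (t n + τ p * (t (n + 1) - t n)))
    (uIL : ℝ → Fin D → ℝ)
    (hIL : ∀ n < M, ∀ s ∈ Set.Ico (t n) (t (n + 1)),
      uIL s = u n + (t (n + 1) - t n) •
        ∑ p, (∫ ξ in (0:ℝ)..((s - t n) / (t (n + 1) - t n)), (φ p).eval ξ) •
          F (qh n p) (t n + τ p * (t (n + 1) - t n)))
    (hILend : uIL (t M) = u (M - 1) + (t M - t (M - 1)) •
        ∑ p, (∫ ξ in (0:ℝ)..((t M - t (M - 1)) / (t M - t (M - 1))), (φ p).eval ξ) •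
          F (qh (M - 1) p) (t (M - 1) + τ p * (t M - t (M - 1)))) :
    ContinuousOn uIL (Set.Icc (t 0) (t M)) ∧ ∀ n ≤ M, uIL (t n) = u n := by
  have hnode : ∀ n ≤ M, uIL (t n) = u n := by
    intro n hn
    rcases hn.lt_or_eq with hlt | rfl
    · rw [hIL n hlt (t n) ⟨le_rfl, ht n hlt⟩]
      simp
    · obtain ⟨m, rfl⟩ : ∃ m, n = m + 1 := ⟨n - 1, by lia⟩
      have hne : t (m + 1) - t m ≠ 0 := (sub_pos.2 (ht m (by lia))).ne'
      simp only [Nat.add_sub_cancel, div_self hne, ← hw] at hILend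
      rw [hILend, hu m (by lia)]
  refine ⟨continuousOn_Icc_of_grid (fun n hn => (ht n hn).le) fun n hn => ?_, hnode⟩
  have hprim : ∀ p, Continuous fun x : ℝ => ∫ ξ in (0:ℝ)..x, (φ p).eval ξ := fun p =>
    intervalIntegral.continuous_primitive (fun _ _ => (φ p).continuous.intervalIntegrable _ _) 0
  have hcont : Continuous fun s : ℝ => u n + (t (n + 1) - t n) •
      ∑ p, (∫ ξ in (0:ℝ)..((s - t n) / (t (n + 1) - t n)), (φ p).eval ξ) •
        F (qh n p) (t n + τ p * (t (n + 1) - t n)) := by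
    have hcomp : ∀ p, Continuous fun s : ℝ =>
        ∫ ξ in (0:ℝ)..((s - t n) / (t (n + 1) - t n)), (φ p).eval ξ := fun p =>
      (hprim p).comp ((continuous_id.sub continuous_const).div_const _)
    fun_prop
  refine hcont.continuousOn.congr fun s hs => ?_
  rcases hs.2.lt_or_eq with hlt | rfl
  · exact hIL n hn s ⟨hs.1, hlt⟩
  · rw [hnode (n + 1) hn, hu n hn]
    simp only [div_self (sub_pos.2 (ht n hn)).ne', ← hw]
end

section
/- Representation of a smooth function with remainder of order N+2: let D ≥ 1 be an integer, Δt > 0, t_n ∈ ℝ, and let u : [t_n, t_n + Δt] → ℝ^D be (N+2)-times continuously differentiable. Then for every τ ∈ [0,1] one has ‖u(t_n + τΔt) − u(t_n) − Δt · Σ_{p=0}^{N} u'(t_n + τ_p Δt) · ∫_0^τ φ_p(ξ) dξ‖ ≤ (Δt^{N+2}/(N+1)!) · sup_{s ∈ [t_n, t_n+Δt]} ‖u^{(N+2)}(s)‖, where ‖·‖ is the supremum norm on ℝ^D. -/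
open MeasureTheory Matrix Polynomial Topology Filter

/-- Iterated Rolle theorem: if `G 0` vanishes at `n + 1` points, and `G (k + 1)` is the derivative
of `G k` for `k < n`, then `G n` vanishes somewhere. -/
theorem exists_eq_zero_of_iterated_rolle {a b : ℝ} (n : ℕ) (G : ℕ → ℝ → ℝ)
    (hcont : ∀ k < n, ContinuousOn (G k) (Set.Icc a b))
    (hderiv : ∀ k < n, ∀ x ∈ Set.Ioo a b, HasDerivAt (G k) (G (k + 1) x) x)
    (x : Fin (n + 1) → ℝ) (hx : StrictMono x) (hxmem : ∀ i, x i ∈ Set.Icc a b)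
    (hzero : ∀ i, G 0 (x i) = 0) :
    ∃ ξ ∈ Set.Icc a b, G n ξ = 0 := by
  induction n generalizing G with
  | zero => exact ⟨x 0, hxmem 0, hzero 0⟩
  | succ n ih =>
    have hlt (i : Fin (n + 1)) : x i.castSucc < x i.succ := hx i.castSucc_lt_succ
    have hsub (i : Fin (n + 1)) : Set.Ioo (x i.castSucc) (x i.succ) ⊆ Set.Ioo a b :=
      Set.Ioo_subset_Ioo (hxmem _).1 (hxmem _).2
    have hrolle (i : Fin (n + 1)) : ∃ c ∈ Set.Ioo (x i.castSucc) (x i.succ), G 1 c = 0 :=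
      exists_hasDerivAt_eq_zero (hlt i)
        ((hcont 0 n.succ_pos).mono (Set.Icc_subset_Icc (hxmem _).1 (hxmem _).2))
        (by rw [hzero, hzero])
        fun y hy => hderiv 0 n.succ_pos y (hsub i hy)
    choose y hymem hy using hrolle
    refine ih (fun k => G (k + 1)) (fun k hk => hcont _ (by lia))
      (fun k hk => hderiv _ (by lia)) y ?_ (fun i => Set.Ioo_subset_Icc_self (hsub i (hymem i))) hy
    refine fun i j hij => (hymem i).2.trans_le (le_trans ?_ (hymem j).1.le)
    exact hx.monotone (Fin.succ_le_castSucc_iff.mpr hij)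

/-- Error formula for polynomial interpolation at `n` distinct nodes. -/
theorem exists_sub_interpolant_eq {a b : ℝ} (n : ℕ) (G : ℕ → ℝ → ℝ)
    (hcont : ∀ k < n, ContinuousOn (G k) (Set.Icc a b))
    (hderiv : ∀ k < n, ∀ x ∈ Set.Ioo a b, HasDerivAt (G k) (G (k + 1) x) x)
    (t : Fin n → ℝ) (ht : StrictMono t) (htmem : ∀ i, t i ∈ Set.Icc a b)
    (P : ℝ[X]) (hP : P.degree < n) (hPt : ∀ i, P.eval (t i) = G 0 (t i))
    {x : ℝ} (hx : x ∈ Set.Icc a b) :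
    ∃ ξ ∈ Set.Icc a b, G 0 x - P.eval x = G n ξ / n.factorial * ∏ i, (x - t i) := by
  by_cases hxt : ∃ i, x = t i
  · obtain ⟨i, rfl⟩ := hxt
    refine ⟨t i, hx, ?_⟩
    rw [Finset.prod_eq_zero (Finset.mem_univ i) (sub_self _), hPt, sub_self, mul_zero]
  push Not at hxt
  have hprod : ∏ i, (x - t i) ≠ 0 :=
    Finset.prod_ne_zero_iff.mpr fun i _ => sub_ne_zero.mpr (hxt i)
  set W : ℝ[X] := Lagrange.nodal Finset.univ t with hW
  have hWdeg : W.natDegree = n := by simp [hW]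
  have hWmonic : W.Monic := Lagrange.nodal_monic
  have hWx : W.eval x = ∏ i, (x - t i) := Lagrange.eval_nodal
  set K : ℝ := (G 0 x - P.eval x) / ∏ i, (x - t i) with hK
  set Q : ℝ[X] := P + C K * W with hQ
  have hQn (ξ : ℝ) : (derivative^[n] Q).eval ξ = K * n.factorial := by
    have hWn : derivative^[n] W = C (n.factorial : ℝ) := by
      ext m
      rw [coeff_iterate_derivative, coeff_C]
      rcases Nat.eq_zero_or_pos m with rfl | hm
      · have : W.coeff n = 1 := by simpa [Monic, leadingCoeff, hWdeg] using hWmonic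
        simp [this, Nat.descFactorial_self]
      · rw [coeff_eq_zero_of_natDegree_lt (by lia), if_neg hm.ne', smul_zero]
    rw [hQ, iterate_map_add, iterate_derivative_C_mul, hWn]
    rw [iterate_derivative_eq_zero_of_degree_lt hP]
    simp
  let s : Finset ℝ := insert x (Finset.univ.image t)
  have hs : s.card = n + 1 := by
    rw [Finset.card_insert_of_notMem (by simpa [eq_comm] using hxt),
      Finset.card_image_of_injective _ ht.injective, Finset.card_univ, Fintype.card_fin]
  have hsmem : ∀ y ∈ s, y ∈ Set.Icc a b ∧ G 0 y - Q.eval y = 0 := by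
    intro y hy
    rcases Finset.mem_insert.mp hy with rfl | hy
    · refine ⟨hx, ?_⟩
      rw [hQ, eval_add, eval_mul, eval_C, hWx, hK, div_mul_cancel₀ _ hprod]
      ring
    · obtain ⟨i, -, rfl⟩ := Finset.mem_image.mp hy
      refine ⟨htmem i, ?_⟩
      rw [hQ, eval_add, eval_mul, hW, Lagrange.eval_nodal_at_node (Finset.mem_univ i), hPt]
      ring
  obtain ⟨ξ, hξ, hξ0⟩ := exists_eq_zero_of_iterated_rolle (a := a) (b := b) n
    (fun k y => G k y - (derivative^[k] Q).eval y)
    (fun k hk => (hcont k hk).sub (derivative^[k] Q).continuous.continuousOn)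
    (fun k hk y hy => by
      rw [Function.iterate_succ_apply']
      exact (hderiv k hk y hy).sub ((derivative^[k] Q).hasDerivAt y))
    (s.orderEmbOfFin hs) (s.orderEmbOfFin hs).strictMono
    (fun i => (hsmem _ (s.orderEmbOfFin_mem hs i)).1)
    (fun i => (hsmem _ (s.orderEmbOfFin_mem hs i)).2)
  refine ⟨ξ, hξ, ?_⟩
  rw [hQn, sub_eq_zero] at hξ0
  rw [hξ0, mul_div_cancel_right₀ _ (by positivity), hK, div_mul_cancel₀ _ hprod]

theorem le_biSup_of_bddAbove {ι : Type*} {f : ι → ℝ} {s : Set ι} (hf : ∀ i, 0 ≤ f i)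
    (hs : BddAbove (f '' s)) {i : ι} (hi : i ∈ s) : f i ≤ ⨆ j ∈ s, f j := by
  obtain ⟨B, hB⟩ := hs
  have hB' : ∀ j ∈ s, f j ≤ B := fun j hj => hB ⟨j, hj, rfl⟩
  have hbdd : BddAbove (Set.range fun j => ⨆ _ : j ∈ s, f j) := by
    refine ⟨B, ?_⟩
    rintro _ ⟨j, rfl⟩
    exact Real.iSup_le (hB' j) ((hf i).trans (hB' i hi))
  exact le_ciSup_of_le hbdd i (by rw [ciSup_pos hi])

/-- Representation of a smooth function in the span `Φ` with remainder of
order `N+2`. -/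
theorem aderdg_smooth_representation_remainder
    (N : ℕ) (hN : 1 ≤ N)
    (τ : Fin (N + 1) → ℝ) (hτ : StrictMono τ)
    (hτmem : ∀ k, τ k ∈ Set.Ioo (0 : ℝ) 1)
    (horth : ∀ j : ℕ, j ≤ N →
      ∫ ξ in (0:ℝ)..1, ξ ^ j * ∏ k, (ξ - τ k) = 0)
    (φ : Fin (N + 1) → Polynomial ℝ)
    (hφdeg : ∀ p, (φ p).natDegree ≤ N)
    (hφeval : ∀ p q, (φ p).eval (τ q) = if p = q then 1 else 0)
    (D : ℕ) (hD : 1 ≤ D) (Δt : ℝ) (hΔt : 0 < Δt) (tn : ℝ)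
    (u : ℝ → Fin D → ℝ)
    (hu : ContDiffOn ℝ (N + 2 : ℕ) u (Set.Icc tn (tn + Δt))) :
    ∀ τ' ∈ Set.Icc (0:ℝ) 1,
      ‖u (tn + τ' * Δt) - u tn - Δt •
          ∑ p, (∫ ξ in (0:ℝ)..τ', (φ p).eval ξ) •
            derivWithin u (Set.Icc tn (tn + Δt)) (tn + τ p * Δt)‖ ≤
        Δt ^ (N + 2) / (Nat.factorial (N + 1) : ℝ) *
          ⨆ s ∈ Set.Icc tn (tn + Δt),
            ‖iteratedDerivWithin (N + 2) u (Set.Icc tn (tn + Δt)) s‖ := by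
  intro τ' hτ'
  set s : Set ℝ := Set.Icc tn (tn + Δt) with hs
  have huniq : UniqueDiffOn ℝ s := uniqueDiffOn_Icc (by linarith)
  set S : ℝ := ⨆ y ∈ s, ‖iteratedDerivWithin (N + 2) u s y‖ with hS
  have hnorm : ∀ y ∈ s, ‖iteratedDerivWithin (N + 2) u s y‖ ≤ S := fun y hy =>
    le_biSup_of_bddAbove (f := fun y => ‖iteratedDerivWithin (N + 2) u s y‖)
      (fun _ => norm_nonneg _)
      (isCompact_Icc.bddAbove_image (hu.continuousOn_iteratedDerivWithin le_rfl huniq).norm) hy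
  have hS0 : 0 ≤ S := (norm_nonneg _).trans (hnorm tn ⟨le_rfl, by linarith⟩)
  have hmaps : Set.MapsTo (fun ξ : ℝ => tn + ξ * Δt) (Set.Icc 0 1) s := fun ξ hξ =>
    ⟨by nlinarith [hξ.1], by nlinarith [hξ.2]⟩
  have hnhds {ξ : ℝ} (hξ : ξ ∈ Set.Ioo (0 : ℝ) 1) : s ∈ 𝓝 (tn + ξ * Δt) :=
    Icc_mem_nhds (by nlinarith [hξ.1]) (by nlinarith [hξ.2])
  refine (pi_norm_le_iff_of_nonneg (by positivity)).mpr fun i => ?_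
  let F : ℕ → ℝ → ℝ := fun k ξ => iteratedDerivWithin k u s (tn + ξ * Δt) i
  have hFcont : ∀ k ≤ N + 2, ContinuousOn (F k) (Set.Icc 0 1) := fun k hk =>
    (continuous_apply i).comp_continuousOn
      ((hu.continuousOn_iteratedDerivWithin (by exact_mod_cast hk) huniq).comp
        (by fun_prop) hmaps)
  have hFderiv : ∀ k < N + 2, ∀ ξ ∈ Set.Ioo (0 : ℝ) 1,
      HasDerivAt (F k) (Δt * F (k + 1) ξ) ξ := by
    intro k hk ξ hξ
    have h1 : HasDerivAt (iteratedDerivWithin k u s)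
        (iteratedDerivWithin (k + 1) u s (tn + ξ * Δt)) (tn + ξ * Δt) := by
      rw [iteratedDerivWithin_succ]
      exact ((hu.differentiableOn_iteratedDerivWithin (by exact_mod_cast hk) huniq) _
        (hmaps (Set.Ioo_subset_Icc_self hξ))).hasDerivWithinAt.hasDerivAt (hnhds hξ)
    have h2 : HasDerivAt (fun ξ : ℝ => tn + ξ * Δt) Δt ξ := by
      simpa using ((hasDerivAt_id ξ).mul_const Δt).const_add tn
    exact (hasDerivAt_pi.mp h1 i).scomp ξ h2
  set P : ℝ[X] := ∑ p, C (F 1 (τ p)) * φ p with hP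
  have hPdeg : P.degree < (N + 1 : ℕ) := by
    refine (degree_lt_iff_coeff_zero _ _).mpr fun m hm => ?_
    rw [hP, finsetSum_coeff]
    refine Finset.sum_eq_zero fun p _ => ?_
    rw [coeff_C_mul, coeff_eq_zero_of_natDegree_lt ((hφdeg p).trans_lt hm), mul_zero]
  have hPτ (q : Fin (N + 1)) : P.eval (τ q) = F 1 (τ q) := by
    simp [hP, eval_finsetSum, hφeval]
  have herr : ∀ x ∈ Set.Icc (0 : ℝ) 1,
      ‖F 1 x - P.eval x‖ ≤ Δt ^ (N + 1) * S / (N + 1).factorial := by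
    intro x hx
    obtain ⟨ξ, hξ, h⟩ := exists_sub_interpolant_eq (a := 0) (b := 1) (N + 1)
      (fun k ξ => Δt ^ k * F (k + 1) ξ)
      (fun k hk => continuousOn_const.mul (hFcont _ (by lia)))
      (fun k hk y hy => by
        simpa only [pow_succ, mul_assoc] using
          (hFderiv (k + 1) (by lia) y hy).const_mul (Δt ^ k))
      τ hτ (fun k => Set.Ioo_subset_Icc_self (hτmem k)) P hPdeg
      (fun q => by simpa using hPτ q) hx
    simp only [pow_zero, one_mul, zero_add] at h
    have hprod : ‖∏ k, (x - τ k)‖ ≤ 1 := by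
      rw [norm_prod]
      refine Finset.prod_le_one (fun _ _ => norm_nonneg _) fun k _ => ?_
      rw [Real.norm_eq_abs, abs_le]
      constructor <;> linarith [hx.1, hx.2, (hτmem k).1, (hτmem k).2]
    have hFS : ‖F (N + 2) ξ‖ ≤ S := (norm_le_pi_norm _ i).trans (hnorm _ (hmaps hξ))
    rw [h, norm_mul, norm_div, norm_mul, norm_pow, Real.norm_of_nonneg hΔt.le, Real.norm_natCast]
    calc _ ≤ Δt ^ (N + 1) * ‖F (N + 2) ξ‖ / (N + 1).factorial * 1 := by gcongr
      _ ≤ _ := by rw [mul_one]; gcongr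
  have hsub : Set.Icc 0 τ' ⊆ Set.Icc (0 : ℝ) 1 := Set.Icc_subset_Icc_right hτ'.2
  have hFint : IntervalIntegrable (F 1) volume 0 τ' :=
    ((hFcont 1 (by lia)).mono (by rwa [Set.uIcc_of_le hτ'.1])).intervalIntegrable
  have hftc : ∫ ξ in (0 : ℝ)..τ', Δt * F 1 ξ = F 0 τ' - F 0 0 :=
    intervalIntegral.integral_eq_sub_of_hasDerivAt_of_le hτ'.1
      ((hFcont 0 (by lia)).mono hsub)
      (fun y hy => hFderiv 0 (by lia) y ⟨hy.1, hy.2.trans_le hτ'.2⟩) (hFint.const_mul Δt)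
  have hPint : ∫ ξ in (0 : ℝ)..τ', P.eval ξ =
      ∑ p, (∫ ξ in (0 : ℝ)..τ', (φ p).eval ξ) * F 1 (τ p) := by
    simp only [hP, eval_finsetSum, eval_mul, eval_C]
    rw [intervalIntegral.integral_finsetSum fun p _ =>
      (Continuous.intervalIntegrable (by fun_prop) _ _)]
    simp only [mul_comm (F 1 _), intervalIntegral.integral_mul_const]
  have hmain : (u (tn + τ' * Δt) - u tn - Δt •
      ∑ p, (∫ ξ in (0:ℝ)..τ', (φ p).eval ξ) • derivWithin u s (tn + τ p * Δt)) i =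
      Δt * ∫ ξ in (0 : ℝ)..τ', (F 1 ξ - P.eval ξ) := by
    rw [intervalIntegral.integral_sub hFint (P.continuous.intervalIntegrable _ _), mul_sub,
      ← intervalIntegral.integral_const_mul, hftc, hPint]
    simp [F, iteratedDerivWithin_one, Finset.sum_apply]
  rw [hmain, norm_mul, Real.norm_of_nonneg hΔt.le]
  have hbound := intervalIntegral.norm_integral_le_of_norm_le_const (a := 0) (b := τ')
    (f := fun ξ => F 1 ξ - P.eval ξ) (C := Δt ^ (N + 1) * S / (N + 1).factorial)
    fun y hy => herr y (hsub (Set.Ioc_subset_Icc_self (by rwa [Set.uIoc_of_le hτ'.1] at hy)))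
  rw [sub_zero, abs_of_nonneg hτ'.1] at hbound
  calc _ ≤ Δt * (Δt ^ (N + 1) * S / (N + 1).factorial * τ') := by gcongr
    _ ≤ Δt * (Δt ^ (N + 1) * S / (N + 1).factorial * 1) := by gcongr; exact hτ'.2
    _ = _ := by ring
end

section
/- Approximation order N+2 of the improved local solution: assume the matrix K is invertible and set A = K⁻¹M. Let D ≥ 1, t_0 < t_f, let L_F ≥ 0, let F : ℝ^D × ℝ → ℝ^D satisfy the Lipschitz condition ‖F(x,t) − F(y,t)‖ ≤ L_F ‖x − y‖ for all x, y ∈ ℝ^D and all t ∈ [t_0, t_f], and let u : [t_0, t_f] → ℝ^D be (N+2)-times continuously differentiable with u'(t) = F(u(t), t) for all t ∈ [t_0, t_f]. Fix C_u ≥ 0. Then there exist constants C > 0 and h₀ > 0 such that for every integer M ≥ 1 with Δt := (t_f − t_0)/M ≤ h₀, and for every family of node values u_n ∈ ℝ^D (0 ≤ n ≤ M) and predictor coefficients q̂_{n,p} ∈ ℝ^D (0 ≤ n < M, 0 ≤ p ≤ N) satisfying (i) q̂_{n,p} = u_n + Δt · Σ_{q=0}^{N} A_{pq} F(q̂_{n,q},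 t_n + τ_q Δt) for all n, p, where t_n = t_0 + nΔt, and (ii) ‖u_n − u(t_n)‖ ≤ C_u · Δt^{2N+1} for all 0 ≤ n ≤ M, the improved local solution q^{IL}_n(τ) = u_n + Δt · Σ_{p=0}^{N} F(q̂_{n,p}, t_n + τ_p Δt) · ∫_0^τ φ_p(ξ) dξ satisfies sup_{0 ≤ n < M} sup_{τ ∈ [0,1]} ‖q^{IL}_n(τ) − u(t_n + τΔt)‖ ≤ C · Δt^{N+2}. -/
open MeasureTheory Matrix Polynomial Topology Filter

section LocalTaylor

variable {E : Type*} [NormedAddCommGroup E] [NormedSpace ℝ E]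

/-- Integrating an approximate polynomial expansion of the derivative. -/
theorem norm_sub_integrated_expansion_le {f f' : ℝ → E} {a b C : ℝ} (hC : 0 ≤ C) {m : ℕ}
    {c : ℕ → E} (hf : ∀ x ∈ Set.Icc a b, HasDerivWithinAt f (f' x) (Set.Icc a b) x)
    (hc : ∀ x ∈ Set.Icc a b, ‖f' x - ∑ k ∈ Finset.range m, (x - a) ^ k • c k‖ ≤ C * (x - a) ^ m)
    {x : ℝ} (hx : x ∈ Set.Icc a b) :
    ‖f x - (f a + ∑ k ∈ Finset.range m, ((x - a) ^ (k + 1) / (k + 1)) • c k)‖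
      ≤ C * (x - a) ^ (m + 1) := by
  have hsub : Set.Icc a x ⊆ Set.Icc a b := Set.Icc_subset_Icc_right hx.2
  have hder : ∀ y ∈ Set.Icc a x, HasDerivWithinAt
      (fun y ↦ f y - ∑ k ∈ Finset.range m, ((y - a) ^ (k + 1) / (k + 1)) • c k)
      (f' y - ∑ k ∈ Finset.range m, (y - a) ^ k • c k) (Set.Icc a x) y := by
    intro y hy
    refine ((hf y (hsub hy)).mono hsub).sub (HasDerivWithinAt.fun_sum fun k _ ↦ ?_)
    have h1 : HasDerivAt (fun y : ℝ ↦ (y - a) ^ (k + 1) / ((k : ℝ) + 1)) ((y - a) ^ k) y := by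
      have h2 := (((hasDerivAt_id y).sub_const a).pow (k + 1)).div_const ((k : ℝ) + 1)
      refine h2.congr_deriv ?_
      have : (k : ℝ) + 1 ≠ 0 := by positivity
      simp only [id, Nat.cast_add, Nat.cast_one, Nat.add_sub_cancel]
      field_simp
    exact (h1.smul_const (c k)).hasDerivWithinAt
  have hbound : ∀ y ∈ Set.Icc a x,
      ‖f' y - ∑ k ∈ Finset.range m, (y - a) ^ k • c k‖ ≤ C * (x - a) ^ m := by
    intro y hy
    refine (hc y (hsub hy)).trans ?_
    have := hy.1
    gcongr
    exact hy.2
  have h := (convex_Icc a x).norm_image_sub_le_of_norm_hasDerivWithin_le hder hbound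
    (Set.left_mem_Icc.2 hx.1) (Set.right_mem_Icc.2 hx.1)
  have hxa : ‖x - a‖ = x - a := by
    rw [Real.norm_eq_abs, abs_of_nonneg (by linarith [hx.1])]
  rw [hxa] at h
  calc _ = _ := by congr 1; simp; abel
    _ ≤ _ := h
    _ = _ := by ring

/-- A `C^m` function on a compact interval has local expansions to order `m`, with an error
constant that does not depend on the base point. -/
theorem exists_uniform_local_expansion {s b : ℝ} (hsb : s < b) (m : ℕ) (f : ℝ → E)
    (hf : ContDiffOn ℝ m f (Set.Icc s b)) :
    ∃ C, 0 ≤ C ∧ ∀ a ∈ Set.Icc s b, ∃ c : ℕ → E, ∀ x ∈ Set.Icc a b,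
      ‖f x - ∑ k ∈ Finset.range m, (x - a) ^ k • c k‖ ≤ C * (x - a) ^ m := by
  induction m generalizing f with
  | zero =>
    obtain ⟨C, hC⟩ := isCompact_Icc.exists_bound_of_continuousOn hf.continuousOn
    refine ⟨C, (norm_nonneg _).trans (hC s (Set.left_mem_Icc.2 hsb.le)), fun a ha ↦
      ⟨0, fun x hx ↦ ?_⟩⟩
    simpa using hC x ⟨ha.1.trans hx.1, hx.2⟩
  | succ m ih =>
    have hud := uniqueDiffOn_Icc hsb
    have hdiff : DifferentiableOn ℝ f (Set.Icc s b) := hf.differentiableOn (by simp)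
    obtain ⟨C, hC, h⟩ := ih (derivWithin f (Set.Icc s b)) (hf.derivWithin hud (by simp))
    refine ⟨C, hC, fun a ha ↦ ?_⟩
    obtain ⟨c, hc⟩ := h a ha
    have hsub : Set.Icc a b ⊆ Set.Icc s b := Set.Icc_subset_Icc_left ha.1
    refine ⟨fun k ↦ Nat.casesOn k (f a) fun k ↦ ((k : ℝ) + 1)⁻¹ • c k, fun x hx ↦ ?_⟩
    have h3 := norm_sub_integrated_expansion_le hC
      (fun y hy ↦ ((hdiff y (hsub hy)).hasDerivWithinAt).mono hsub) hc hx
    rw [Finset.sum_range_succ']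
    simpa [smul_smul, div_eq_mul_inv, add_comm] using h3

end LocalTaylor

section Quadrature

variable {E : Type*} [NormedAddCommGroup E] [NormedSpace ℝ E] {ι : Type*} [Fintype ι]

/-- Error of an integration rule with weights `β` and nodes `τ` that integrates monomials of degree
less than `m` exactly over `[0, σ]`. -/
theorem norm_quadrature_sub_le {f f' : ℝ → E} {a b h C : ℝ} (hC : 0 ≤ C) {m : ℕ} {c : ℕ → E}
    (hf : ∀ x ∈ Set.Icc a b, HasDerivWithinAt f (f' x) (Set.Icc a b) x)
    (hc : ∀ x ∈ Set.Icc a b, ‖f' x - ∑ k ∈ Finset.range m, (x - a) ^ k • c k‖ ≤ C * (x - a) ^ m)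
    (hh : 0 ≤ h) (hab : a + h ≤ b) {τ β : ι → ℝ} (hτ : ∀ i, τ i ∈ Set.Icc (0 : ℝ) 1)
    {σ : ℝ} (hσ : σ ∈ Set.Icc (0 : ℝ) 1)
    (hβ : ∀ k < m, ∑ i, β i * τ i ^ k = σ ^ (k + 1) / (k + 1)) :
    ‖f a + h • ∑ i, β i • f' (a + τ i * h) - f (a + σ * h)‖
      ≤ (∑ i, |β i| + 1) * C * h ^ (m + 1) := by
  have hmem : ∀ r ∈ Set.Icc (0 : ℝ) 1, a + r * h ∈ Set.Icc a b := fun r hr ↦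
    ⟨by nlinarith [hr.1], by nlinarith [hr.2]⟩
  have hpow : ∀ r ∈ Set.Icc (0 : ℝ) 1, ∀ j : ℕ, C * (a + r * h - a) ^ j ≤ C * h ^ j := by
    intro r hr j
    have h0 : 0 ≤ r * h := mul_nonneg hr.1 hh
    have h1 : r * h ≤ h := mul_le_of_le_one_left hh hr.2
    rw [add_sub_cancel_left]
    gcongr
  have hlast := (norm_sub_integrated_expansion_le hC hf hc (hmem σ hσ)).trans
    (hpow σ hσ (m + 1))
  have hnode : ‖∑ i, β i • (f' (a + τ i * h) -
      ∑ k ∈ Finset.range m, (a + τ i * h - a) ^ k • c k)‖ ≤ (∑ i, |β i|) * (C * h ^ m) := by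
    rw [Finset.sum_mul]
    refine norm_sum_le_of_le _ fun i _ ↦ ?_
    rw [norm_smul, Real.norm_eq_abs]
    gcongr
    exact (hc _ (hmem _ (hτ i))).trans (hpow _ (hτ i) m)
  have hsum : h • ∑ i, β i • ∑ k ∈ Finset.range m, (a + τ i * h - a) ^ k • c k
      = ∑ k ∈ Finset.range m, ((a + σ * h - a) ^ (k + 1) / (k + 1)) • c k := by
    simp only [Finset.smul_sum, smul_smul, add_sub_cancel_left]
    rw [Finset.sum_comm]
    refine Finset.sum_congr rfl fun k hk ↦ ?_
    rw [← Finset.sum_smul]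
    congr 1
    rw [mul_pow, mul_div_right_comm, ← hβ k (Finset.mem_range.1 hk), Finset.sum_mul]
    exact Finset.sum_congr rfl fun i _ ↦ by ring
  have hsplit : f a + h • ∑ i, β i • f' (a + τ i * h) - f (a + σ * h)
      = h • ∑ i, β i • (f' (a + τ i * h) -
          ∑ k ∈ Finset.range m, (a + τ i * h - a) ^ k • c k)
        - (f (a + σ * h) - (f a +
          ∑ k ∈ Finset.range m, ((a + σ * h - a) ^ (k + 1) / (k + 1)) • c k)) := by
    rw [← hsum]
    simp only [smul_sub, Finset.sum_sub_distrib]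
    abel
  rw [hsplit]
  refine (norm_sub_le _ _).trans ?_
  rw [norm_smul, Real.norm_of_nonneg hh]
  calc _ ≤ h * ((∑ i, |β i|) * (C * h ^ m)) + C * h ^ (m + 1) := by gcongr
    _ = _ := by ring

/-- Error of one step of a quadrature rule applied to perturbed data of an ODE. -/
theorem norm_perturbed_quadrature_sub_le {u : ℝ → E} {F : E → ℝ → E} {a b h C L : ℝ}
    (hC : 0 ≤ C) {m : ℕ} {c : ℕ → E}
    (hu : ∀ x ∈ Set.Icc a b, HasDerivWithinAt u (F (u x) x) (Set.Icc a b) x)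
    (hF : ∀ x y, ∀ t ∈ Set.Icc a b, ‖F x t - F y t‖ ≤ L * ‖x - y‖) (hL : 0 ≤ L)
    (hc : ∀ x ∈ Set.Icc a b,
      ‖F (u x) x - ∑ k ∈ Finset.range m, (x - a) ^ k • c k‖ ≤ C * (x - a) ^ m)
    (hh : 0 ≤ h) (hab : a + h ≤ b) {τ β : ι → ℝ} (hτ : ∀ i, τ i ∈ Set.Icc (0 : ℝ) 1)
    {σ : ℝ} (hσ : σ ∈ Set.Icc (0 : ℝ) 1)
    (hβ : ∀ k < m, ∑ i, β i * τ i ^ k = σ ^ (k + 1) / (k + 1)) (v : E) (q : ι → E) :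
    ‖v + h • ∑ i, β i • F (q i) (a + τ i * h) - u (a + σ * h)‖
      ≤ ‖v - u a‖ + h * ((∑ i, |β i|) * (L * ‖fun i ↦ q i - u (a + τ i * h)‖))
        + (∑ i, |β i| + 1) * C * h ^ (m + 1) := by
  have hexact := norm_quadrature_sub_le hC hu hc hh hab hτ hσ hβ
  have hpert : ‖∑ i, β i • (F (q i) (a + τ i * h) - F (u (a + τ i * h)) (a + τ i * h))‖
      ≤ (∑ i, |β i|) * (L * ‖fun i ↦ q i - u (a + τ i * h)‖) := by
    rw [Finset.sum_mul]
    refine norm_sum_le_of_le _ fun i _ ↦ ?_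
    rw [norm_smul, Real.norm_eq_abs]
    have ht : a + τ i * h ∈ Set.Icc a b :=
      ⟨by nlinarith [(hτ i).1], by nlinarith [(hτ i).2]⟩
    gcongr
    refine (hF _ _ _ ht).trans ?_
    gcongr
    exact norm_le_pi_norm (fun i ↦ q i - u (a + τ i * h)) i
  have hsplit : v + h • ∑ i, β i • F (q i) (a + τ i * h) - u (a + σ * h)
      = (v - u a)
        + h • ∑ i, β i • (F (q i) (a + τ i * h) - F (u (a + τ i * h)) (a + τ i * h))
        + (u a + h • ∑ i, β i • F (u (a + τ i * h)) (a + τ i * h) - u (a + σ * h)) := by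
    simp only [smul_sub, Finset.sum_sub_distrib]
    abel
  rw [hsplit]
  refine (norm_add₃_le).trans ?_
  rw [norm_smul, Real.norm_of_nonneg hh]
  gcongr

end Quadrature

section Collocation

variable {N : ℕ} {τ : Fin (N + 1) → ℝ} {φ : Fin (N + 1) → ℝ[X]}

theorem sum_smul_eq_of_natDegree_le (hτ : StrictMono τ) (hφdeg : ∀ p, (φ p).natDegree ≤ N)
    (hφeval : ∀ p q, (φ p).eval (τ q) = if p = q then 1 else 0) {P : ℝ[X]}
    (hP : P.natDegree ≤ N) : ∑ p, P.eval (τ p) • φ p = P := by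
  refine Polynomial.eq_of_natDegree_lt_card_of_eval_eq _ _ hτ.injective (fun i ↦ ?_) ?_
  · simp [Polynomial.eval_finsetSum, hφeval]
  · rw [Fintype.card_fin, max_lt_iff]
    refine ⟨Nat.lt_succ_of_le ?_, Nat.lt_succ_of_le hP⟩
    exact Polynomial.natDegree_sum_le_of_forall_le _ _ fun p _ ↦
      (Polynomial.natDegree_smul_le _ _).trans (hφdeg p)

theorem sum_integral_mul_pow (hτ : StrictMono τ) (hφdeg : ∀ p, (φ p).natDegree ≤ N)
    (hφeval : ∀ p q, (φ p).eval (τ q) = if p = q then 1 else 0) (σ : ℝ) {k : ℕ} (hk : k ≤ N) :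
    ∑ p, (∫ ξ in (0 : ℝ)..σ, (φ p).eval ξ) * τ p ^ k = σ ^ (k + 1) / (k + 1) := by
  have hX := sum_smul_eq_of_natDegree_le hτ hφdeg hφeval
    ((Polynomial.natDegree_X_pow_le k).trans hk)
  have hX' : ∀ ξ : ℝ, ∑ p, (φ p).eval ξ * τ p ^ k = ξ ^ k := fun ξ ↦ by
    simpa [Polynomial.eval_finsetSum, mul_comm] using congrArg (Polynomial.eval ξ) hX
  simp only [← intervalIntegral.integral_mul_const]
  rw [← intervalIntegral.integral_finsetSum fun p _ ↦
    Continuous.intervalIntegrable (by fun_prop) _ _]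
  simp [hX', integral_pow]

theorem integral_prod_mul_eval_eq_zero
    (horth : ∀ j : ℕ, j ≤ N → ∫ ξ in (0 : ℝ)..1, ξ ^ j * ∏ k, (ξ - τ k) = 0) {P : ℝ[X]}
    (hP : P.natDegree ≤ N) : ∫ ξ in (0 : ℝ)..1, (∏ k, (ξ - τ k)) * P.eval ξ = 0 := by
  have h : ∀ ξ : ℝ, (∏ k, (ξ - τ k)) * P.eval ξ
      = ∑ j ∈ Finset.range (N + 1), P.coeff j * (ξ ^ j * ∏ k, (ξ - τ k)) := fun ξ ↦ by
    rw [Polynomial.eval_eq_sum_range' (Nat.lt_succ_of_le hP), Finset.mul_sum]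
    exact Finset.sum_congr rfl fun j _ ↦ by ring
  simp only [h]
  rw [intervalIntegral.integral_finsetSum fun j _ ↦
    Continuous.intervalIntegrable (by fun_prop) _ _]
  refine Finset.sum_eq_zero fun j hj ↦ ?_
  rw [intervalIntegral.integral_const_mul, horth j (Nat.lt_succ_iff.1 (Finset.mem_range.1 hj)),
    mul_zero]

/-- Gauss quadrature is exact on products of a Lagrange basis polynomial with a polynomial of
degree at most `N`. -/
theorem integral_lagrange_mul_eval (hτ : StrictMono τ)
    (horth : ∀ j : ℕ, j ≤ N → ∫ ξ in (0 : ℝ)..1, ξ ^ j * ∏ k, (ξ - τ k) = 0)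
    (hφdeg : ∀ p, (φ p).natDegree ≤ N)
    (hφeval : ∀ p q, (φ p).eval (τ q) = if p = q then 1 else 0) (p : Fin (N + 1)) {P : ℝ[X]}
    (hP : P.natDegree ≤ N) :
    ∫ ξ in (0 : ℝ)..1, (φ p).eval ξ * P.eval ξ
      = (∫ ξ in (0 : ℝ)..1, (φ p).eval ξ) * P.eval (τ p) := by
  have hdvd : Lagrange.nodal Finset.univ τ ∣ φ p * (P - C (P.eval (τ p))) := by
    rw [Lagrange.nodal]
    refine Finset.prod_dvd_of_coprime
      (fun i _ j _ hij ↦ Polynomial.isCoprime_X_sub_C_of_isUnit_sub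
        (sub_ne_zero.2 (hτ.injective.ne hij)).isUnit) fun q _ ↦ ?_
    rw [Polynomial.dvd_iff_isRoot, Polynomial.IsRoot.def, Polynomial.eval_mul, hφeval]
    split_ifs with h
    · simp [h]
    · simp
  obtain ⟨Q, hQ⟩ := hdvd
  have hQdeg : Q.natDegree ≤ N := by
    rcases eq_or_ne Q 0 with rfl | hQ0
    · simp
    have h1 : (Lagrange.nodal Finset.univ τ * Q).natDegree = N + 1 + Q.natDegree := by
      rw [(Lagrange.nodal_monic).natDegree_mul' hQ0, Lagrange.natDegree_nodal]
      simp
    have h2 : (φ p * (P - C (P.eval (τ p)))).natDegree ≤ N + N :=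
      Polynomial.natDegree_mul_le_of_le (hφdeg p) ((Polynomial.natDegree_sub_C).trans_le hP)
    rw [hQ] at h2
    omega
  have h0 := integral_prod_mul_eval_eq_zero horth hQdeg
  have hpt : ∀ ξ : ℝ, (∏ k, (ξ - τ k)) * Q.eval ξ
      = (φ p).eval ξ * P.eval ξ - (φ p).eval ξ * P.eval (τ p) := fun ξ ↦ by
    have := congrArg (Polynomial.eval ξ) hQ
    simp only [Polynomial.eval_mul, Polynomial.eval_sub, Polynomial.eval_C,
      Lagrange.eval_nodal] at this
    rw [← this]
    ring
  simp only [hpt] at h0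
  rw [intervalIntegral.integral_sub (Continuous.intervalIntegrable (by fun_prop) _ _)
    (Continuous.intervalIntegrable (by fun_prop) _ _), intervalIntegral.integral_mul_const] at h0
  exact sub_eq_zero.1 h0

/-- The rows of the predictor matrix integrate monomials of degree less than `N` exactly up to the
nodes. -/
theorem sum_predictor_mul_pow (hτ : StrictMono τ)
    (horth : ∀ j : ℕ, j ≤ N → ∫ ξ in (0 : ℝ)..1, ξ ^ j * ∏ k, (ξ - τ k) = 0)
    (hφdeg : ∀ p, (φ p).natDegree ≤ N)
    (hφeval : ∀ p q, (φ p).eval (τ q) = if p = q then 1 else 0)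
    {w : Fin (N + 1) → ℝ} (hw : ∀ p, w p = ∫ t in (0 : ℝ)..1, (φ p).eval t)
    {K : Matrix (Fin (N + 1)) (Fin (N + 1)) ℝ}
    (hK : ∀ p q, K p q = (φ p).eval 0 * (φ q).eval 0 +
      ∫ t in (0 : ℝ)..1, (φ p).eval t * (φ q).derivative.eval t)
    (hKdet : IsUnit K.det) {k : ℕ} (hk : k < N) (p : Fin (N + 1)) :
    ∑ q, (K⁻¹ * Matrix.diagonal w) p q * τ q ^ k = τ p ^ (k + 1) / (k + 1) := by
  have hX := sum_smul_eq_of_natDegree_le hτ hφdeg hφeval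
    ((Polynomial.natDegree_X_pow_le (k + 1)).trans hk)
  have hX0 : ∑ q, (φ q).eval 0 * τ q ^ (k + 1) = 0 := by
    simpa [Polynomial.eval_finsetSum, mul_comm] using congrArg (Polynomial.eval 0) hX
  have hX' : ∀ ξ : ℝ, ∑ q, (φ q).derivative.eval ξ * τ q ^ (k + 1) = (k + 1) * ξ ^ k := fun ξ ↦ by
    simpa [Polynomial.eval_finsetSum, mul_comm] using
      congrArg (fun P ↦ Polynomial.eval ξ (Polynomial.derivative P)) hX
  have hKv : K *ᵥ (fun q ↦ τ q ^ (k + 1) / ((k : ℝ) + 1))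
      = Matrix.diagonal w *ᵥ fun q ↦ τ q ^ k := by
    ext r
    have hk0 : (k : ℝ) + 1 ≠ 0 := by positivity
    have hint : ∑ q, (∫ t in (0 : ℝ)..1, (φ r).eval t * (φ q).derivative.eval t) * τ q ^ (k + 1)
        = (k + 1) * (w r * τ r ^ k) := by
      simp only [← intervalIntegral.integral_mul_const]
      rw [← intervalIntegral.integral_finsetSum fun q _ ↦
        Continuous.intervalIntegrable (by fun_prop) _ _]
      simp only [mul_assoc, ← Finset.mul_sum, hX']
      have hg := integral_lagrange_mul_eval hτ horth hφdeg hφeval r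
        ((Polynomial.natDegree_X_pow_le (R := ℝ) k).trans hk.le)
      simp only [Polynomial.eval_pow, Polynomial.eval_X] at hg
      rw [hw r, ← hg, ← intervalIntegral.integral_const_mul]
      exact intervalIntegral.integral_congr fun t _ ↦ by ring
    rw [Matrix.mulVec_diagonal]
    simp only [Matrix.mulVec, dotProduct, hK, mul_div_assoc', ← Finset.sum_div]
    rw [div_eq_iff hk0]
    simp only [add_mul, Finset.sum_add_distrib, hint]
    simp only [mul_assoc, ← Finset.mul_sum, hX0]
    ring
  have h := congrArg (fun v ↦ K⁻¹ *ᵥ v) hKv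
  simp only [Matrix.mulVec_mulVec, Matrix.nonsing_inv_mul K hKdet, Matrix.one_mulVec] at h
  exact (congrFun h p).symm

theorem exists_bound_sum_abs_primitive (φ : Fin (N + 1) → ℝ[X]) :
    ∃ B, ∀ σ ∈ Set.Icc (0 : ℝ) 1, ∑ p, |∫ ξ in (0 : ℝ)..σ, (φ p).eval ξ| ≤ B := by
  have hcont : Continuous fun σ : ℝ ↦ ∑ p, |∫ ξ in (0 : ℝ)..σ, (φ p).eval ξ| :=
    continuous_finsetSum _ fun p _ ↦ (intervalIntegral.continuous_primitive
      (fun a b ↦ (φ p).continuous.intervalIntegrable a b) 0).abs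
  obtain ⟨B, hB⟩ := isCompact_Icc.exists_bound_of_continuousOn
    (hcont.continuousOn (s := Set.Icc (0 : ℝ) 1))
  exact ⟨B, fun σ hσ ↦ (le_abs_self _).trans (hB σ hσ)⟩

end Collocation

/-- Approximation order `N+2` of the improved local solution. -/
theorem aderdg_improved_local_solution_order
    (N : ℕ) (hN : 1 ≤ N)
    (τ : Fin (N + 1) → ℝ) (hτ : StrictMono τ)
    (hτmem : ∀ k, τ k ∈ Set.Ioo (0 : ℝ) 1)
    (horth : ∀ j : ℕ, j ≤ N →
      ∫ ξ in (0:ℝ)..1, ξ ^ j * ∏ k, (ξ - τ k) = 0)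
    (φ : Fin (N + 1) → Polynomial ℝ)
    (hφdeg : ∀ p, (φ p).natDegree ≤ N)
    (hφeval : ∀ p q, (φ p).eval (τ q) = if p = q then 1 else 0)
    (w : Fin (N + 1) → ℝ)
    (hw : ∀ p, w p = ∫ t in (0:ℝ)..1, (φ p).eval t)
    (K : Matrix (Fin (N + 1)) (Fin (N + 1)) ℝ)
    (hK : ∀ p q, K p q = (φ p).eval 0 * (φ q).eval 0 +
      ∫ t in (0:ℝ)..1, (φ p).eval t * (φ q).derivative.eval t)
    (hKdet : IsUnit K.det)
    (A : Matrix (Fin (N + 1)) (Fin (N + 1)) ℝ)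
    (hA : A = K⁻¹ * Matrix.diagonal w)
    (D : ℕ) (hD : 1 ≤ D) (t0 tf : ℝ) (htf : t0 < tf)
    (LF : ℝ) (hLF : 0 ≤ LF)
    (F : (Fin D → ℝ) → ℝ → (Fin D → ℝ))
    (hFlip : ∀ x y : Fin D → ℝ, ∀ t' ∈ Set.Icc t0 tf,
      ‖F x t' - F y t'‖ ≤ LF * ‖x - y‖)
    (u : ℝ → Fin D → ℝ)
    (hu : ContDiffOn ℝ (N + 2 : ℕ) u (Set.Icc t0 tf))
    (hode : ∀ t' ∈ Set.Icc t0 tf,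
      derivWithin u (Set.Icc t0 tf) t' = F (u t') t')
    (Cu : ℝ) (hCu : 0 ≤ Cu) :
    ∃ C > (0:ℝ), ∃ h0 > (0:ℝ),
      ∀ M : ℕ, 1 ≤ M → ∀ Δt : ℝ, Δt = (tf - t0) / M → Δt ≤ h0 →
        ∀ (un : ℕ → Fin D → ℝ) (qh : ℕ → Fin (N + 1) → Fin D → ℝ),
          (∀ n < M, ∀ p, qh n p = un n + Δt •
            ∑ q, A p q • F (qh n q) (t0 + n * Δt + τ q * Δt)) →
          (∀ n ≤ M, ‖un n - u (t0 + n * Δt)‖ ≤ Cu * Δt ^ (2 * N + 1)) →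
          ∀ n < M, ∀ τ' ∈ Set.Icc (0:ℝ) 1,
            ‖(un n + Δt • ∑ p, (∫ ξ in (0:ℝ)..τ', (φ p).eval ξ) •
                F (qh n p) (t0 + n * Δt + τ p * Δt)) -
              u (t0 + n * Δt + τ' * Δt)‖ ≤ C * Δt ^ (N + 2) := by
  have hud := uniqueDiffOn_Icc htf
  have hderiv : ∀ x ∈ Set.Icc t0 tf, HasDerivWithinAt u (F (u x) x) (Set.Icc t0 tf) x := by
    intro x hx
    rw [← hode x hx]
    exact (hu.differentiableOn (by simp) x hx).hasDerivWithinAt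
  have hsmooth : ContDiffOn ℝ (N + 1 : ℕ) (fun x ↦ F (u x) x) (Set.Icc t0 tf) :=
    (hu.derivWithin hud (by norm_cast)).congr fun x hx ↦ (hode x hx).symm
  obtain ⟨C₁, hC₁, hexp₁⟩ := exists_uniform_local_expansion htf N (fun x ↦ F (u x) x)
    (hsmooth.of_le (by norm_cast; omega))
  obtain ⟨C₂, hC₂, hexp₂⟩ := exists_uniform_local_expansion htf (N + 1) (fun x ↦ F (u x) x) hsmooth
  obtain ⟨B, hB⟩ := exists_bound_sum_abs_primitive φ
  have hB0 : 0 ≤ B :=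
    (Finset.sum_nonneg fun p _ ↦ abs_nonneg _).trans (hB 0 (Set.left_mem_Icc.2 zero_le_one))
  set S : ℝ := ∑ p, ∑ q, |A p q| with hS
  have hS0 : 0 ≤ S := Finset.sum_nonneg fun p _ ↦ Finset.sum_nonneg fun q _ ↦ abs_nonneg _
  have hrow : ∀ p, ∑ q, |A p q| ≤ S := fun p ↦
    Finset.single_le_sum (f := fun p ↦ ∑ q, |A p q|)
      (fun p _ ↦ Finset.sum_nonneg fun q _ ↦ abs_nonneg _) (Finset.mem_univ p)
  have hSL : 0 ≤ S * LF := mul_nonneg hS0 hLF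
  refine ⟨Cu + B * (LF * (2 * (Cu + (S + 1) * C₁))) + (B + 1) * C₂ + 1, by positivity,
    min 1 (1 / (2 * (S * LF) + 1)), by positivity, ?_⟩
  intro M hM h hh hle un qh hq hun n hn σ hσ
  have hM0 : (0 : ℝ) < M := by exact_mod_cast hM
  have hpos : 0 < h := hh ▸ div_pos (sub_pos.2 htf) hM0
  have hle1 : h ≤ 1 := hle.trans (min_le_left _ _)
  have hsmall : h * (S * LF) ≤ 1 / 2 := by
    have h1 := hle.trans (min_le_right _ _)
    rw [le_div_iff₀ (by positivity)] at h1
    nlinarith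
  have hMh : (M : ℝ) * h = tf - t0 := by rw [hh]; field_simp
  have hn1 : (n : ℝ) + 1 ≤ M := by exact_mod_cast hn
  set a : ℝ := t0 + n * h with ha
  have hab : a + h ≤ tf := by nlinarith
  have hat : t0 ≤ a := le_add_of_nonneg_right (by positivity)
  have ham : a ∈ Set.Icc t0 tf := ⟨hat, by linarith⟩
  have hsub : Set.Icc a tf ⊆ Set.Icc t0 tf := Set.Icc_subset_Icc_left hat
  have hda : ∀ x ∈ Set.Icc a tf, HasDerivWithinAt u (F (u x) x) (Set.Icc a tf) x := fun x hx ↦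
    (hderiv x (hsub hx)).mono hsub
  have hFa : ∀ x y, ∀ t ∈ Set.Icc a tf, ‖F x t - F y t‖ ≤ LF * ‖x - y‖ := fun x y t ht ↦
    hFlip x y t (hsub ht)
  have hτ01 : ∀ i, τ i ∈ Set.Icc (0 : ℝ) 1 := fun i ↦ Set.Ioo_subset_Icc_self (hτmem i)
  obtain ⟨c₁, hc₁⟩ := hexp₁ a ham
  obtain ⟨c₂, hc₂⟩ := hexp₂ a ham
  have huna := hun n hn.le
  have hpw₁ : Cu * h ^ (2 * N + 1) ≤ Cu * h ^ (N + 1) :=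
    mul_le_mul_of_nonneg_left (pow_le_pow_of_le_one hpos.le hle1 (by omega)) hCu
  have hpw₂ : Cu * h ^ (2 * N + 1) ≤ Cu * h ^ (N + 2) :=
    mul_le_mul_of_nonneg_left (pow_le_pow_of_le_one hpos.le hle1 (by omega)) hCu
  set e : ℝ := ‖fun i ↦ qh n i - u (a + τ i * h)‖ with he
  have he0 : 0 ≤ e := norm_nonneg _
  have hpred : e ≤ 2 * (Cu + (S + 1) * C₁) * h ^ (N + 1) := by
    have hstep : e ≤ Cu * h ^ (N + 1) + h * (S * (LF * e)) + (S + 1) * C₁ * h ^ (N + 1) := by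
      refine (pi_norm_le_iff_of_nonneg (by positivity)).2 fun p ↦ ?_
      have hp := norm_perturbed_quadrature_sub_le hC₁ hda hFa hLF hc₁ hpos.le hab hτ01 (hτ01 p)
        (β := A p) (fun k hk ↦ by
          rw [hA]; exact sum_predictor_mul_pow hτ horth hφdeg hφeval hw hK hKdet hk p)
        (un n) (qh n)
      rw [← hq n hn p] at hp
      refine hp.trans ?_
      gcongr
      · exact huna.trans hpw₁
      · exact hrow p
      · exact hrow p
    have hhalf : h * (S * (LF * e)) ≤ 1 / 2 * e := by
      calc _ = h * (S * LF) * e := by ring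
        _ ≤ _ := by gcongr
    linarith
  have hfin := norm_perturbed_quadrature_sub_le hC₂ hda hFa hLF hc₂ hpos.le hab hτ01 hσ
    (β := fun p ↦ ∫ ξ in (0 : ℝ)..σ, (φ p).eval ξ)
    (fun k hk ↦ sum_integral_mul_pow hτ hφdeg hφeval σ (Nat.lt_succ_iff.1 hk)) (un n) (qh n)
  calc _ ≤ _ := hfin
    _ ≤ Cu * h ^ (N + 2) + h * (B * (LF * (2 * (Cu + (S + 1) * C₁) * h ^ (N + 1))))
        + (B + 1) * C₂ * h ^ (N + 1 + 1) := by
      gcongr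
      · exact huna.trans hpw₂
      · exact hB σ hσ
      · exact hB σ hσ
    _ = (Cu + B * (LF * (2 * (Cu + (S + 1) * C₁))) + (B + 1) * C₂) * h ^ (N + 2) := by ring
    _ ≤ _ := mul_le_mul_of_nonneg_right (by linarith) (by positivity)
end

section
/- ε-embedding limit for DAE systems: assume the matrix K is invertible and set A = K⁻¹M. Let D_u, D_v ≥ 1 be integers, let F : ℝ^{D_u} × ℝ^{D_v} × ℝ → ℝ^{D_u} and G : ℝ^{D_u} × ℝ^{D_v} × ℝ → ℝ^{D_v} be continuous, fix Δt > 0 and real numbers s_0, …, s_N (the quadrature times). Suppose that for every ε > 0 we are given u^ε ∈ ℝ^{D_u}, v^ε ∈ ℝ^{D_v}, and vectors q̂^ε_p ∈ ℝ^{D_u}, r̂^ε_p ∈ ℝ^{D_v} (0 ≤ p ≤ N) satisfying the ε-embedded predictor system q̂^ε_p − Δt · Σ_{q=0}^{N} A_{pq} F(q̂^ε_q, r̂^ε_q, s_q) = u^ε and ε·r̂^ε_p − Δt · Σ_{q=0}^{N} A_{pq} G(q̂^ε_q, r̂^ε_q, s_q) = ε·v^ε for all p. Suppose moreover that as ε →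 0⁺ one has q̂^ε_p → q̂_p, r̂^ε_p → r̂_p, u^ε → u, and v^ε → v. Then the limits satisfy the ADER-DG predictor system for the differential-algebraic system: q̂_p − Δt · Σ_{q=0}^{N} A_{pq} F(q̂_q, r̂_q, s_q) = u and G(q̂_p, r̂_p, s_p) = 0 for every 0 ≤ p ≤ N. -/
open MeasureTheory Matrix Polynomial Topology Filter

/-- If `P` is orthogonal on `[0, 1]` to the monomials of degree at most `N`, then it is orthogonal
to every polynomial of degree at most `N`. -/
theorem integral_eval_mul_eval_eq_zero_of_monomials {N : ℕ} {P : ℝ[X]}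
    (hP : ∀ j : ℕ, j ≤ N → ∫ t in (0:ℝ)..1, t ^ j * P.eval t = 0)
    {Q : ℝ[X]} (hQ : Q.natDegree ≤ N) :
    ∫ t in (0:ℝ)..1, Q.eval t * P.eval t = 0 := by
  have hsum : ∀ t : ℝ, Q.eval t * P.eval t =
      ∑ j ∈ Finset.range (Q.natDegree + 1), Q.coeff j * (t ^ j * P.eval t) := by
    intro t
    rw [Polynomial.eval_eq_sum_range, Finset.sum_mul]
    exact Finset.sum_congr rfl fun j _ => mul_assoc _ _ _
  simp_rw [hsum]
  rw [intervalIntegral.integral_finsetSum fun j _ =>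
    Continuous.intervalIntegrable (by fun_prop) _ _]
  refine Finset.sum_eq_zero fun j hj => ?_
  rw [intervalIntegral.integral_const_mul, hP j (by rw [Finset.mem_range] at hj; omega), mul_zero]

/-- The square of a nonzero real polynomial has positive integral over `[0, 1]`. -/
theorem integral_eval_sq_pos {f : ℝ[X]} (hf : ∃ c ∈ Set.Icc (0:ℝ) 1, f.eval c ≠ 0) :
    0 < ∫ t in (0:ℝ)..1, f.eval t ^ 2 := by
  obtain ⟨c, hc, hfc⟩ := hf
  exact intervalIntegral.integral_pos one_pos (by fun_prop) (fun t _ => sq_nonneg _)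
    ⟨c, hc, by positivity⟩

/-- The weights of Gauss-Legendre quadrature on `[0, 1]` are positive. -/
theorem integral_lagrange_basis_pos_of_orthogonal {N : ℕ} {τ : Fin (N + 1) → ℝ}
    (hτ : Function.Injective τ) (hτmem : ∀ k, τ k ∈ Set.Ioo (0 : ℝ) 1)
    (horth : ∀ j : ℕ, j ≤ N → ∫ ξ in (0:ℝ)..1, ξ ^ j * ∏ k, (ξ - τ k) = 0)
    {f : ℝ[X]} (hfdeg : f.natDegree ≤ N) {p : Fin (N + 1)}
    (hfeval : ∀ q, f.eval (τ q) = if p = q then 1 else 0) :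
    0 < ∫ t in (0:ℝ)..1, f.eval t := by
  set P : ℝ[X] := ∏ k, (X - C (τ k)) with hPdef
  have hPeval : ∀ t, P.eval t = ∏ k, (t - τ k) := fun t => by
    simp [hPdef, Polynomial.eval_prod]
  have hPdeg : P.natDegree = N + 1 := by
    simp [hPdef, Polynomial.natDegree_finsetProd_X_sub_C_eq_card]
  have hdvd : P ∣ f ^ 2 - f := by
    refine Finset.prod_dvd_of_coprime
      (fun i _ j _ hij => Polynomial.pairwise_coprime_X_sub_C hτ hij) fun k _ => ?_
    rw [Polynomial.dvd_iff_isRoot, Polynomial.IsRoot.def]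
    by_cases h : p = k <;> simp [hfeval, h]
  obtain ⟨Q, hQ⟩ := hdvd
  have hQdeg : Q.natDegree ≤ N := by
    by_cases hQ0 : Q = 0
    · simp [hQ0]
    have hP0 : P ≠ 0 := fun h => by simp [h] at hPdeg
    have h1 : (P * Q).natDegree = N + 1 + Q.natDegree := by
      rw [Polynomial.natDegree_mul hP0 hQ0, hPdeg]
    have h2 : (f ^ 2 - f).natDegree ≤ 2 * N :=
      (Polynomial.natDegree_sub_le _ _).trans
        (max_le (Polynomial.natDegree_pow_le.trans (by omega)) (by omega))
    rw [hQ] at h2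
    omega
  have hzero : ∫ t in (0:ℝ)..1, Q.eval t * P.eval t = 0 :=
    integral_eval_mul_eval_eq_zero_of_monomials (by simpa only [hPeval] using horth) hQdeg
  have hsplit : ∀ t, f.eval t = f.eval t ^ 2 - Q.eval t * P.eval t := fun t => by
    have := congrArg (Polynomial.eval t) hQ
    simp only [Polynomial.eval_sub, Polynomial.eval_pow, Polynomial.eval_mul] at this
    linarith
  have hpos := integral_eval_sq_pos (f := f)
    ⟨τ p, Set.Ioo_subset_Icc_self (hτmem p), by simp [hfeval]⟩
  rw [intervalIntegral.integral_congr fun t _ => hsplit t,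
    intervalIntegral.integral_sub (Continuous.intervalIntegrable (by fun_prop) _ _)
      (Continuous.intervalIntegrable (by fun_prop) _ _), hzero, sub_zero]
  exact hpos

/-- ε-embedding limit: the limits of the ε-embedded predictor solutions satisfy
the ADER-DG predictor system for the DAE system. -/
theorem aderdg_eps_embedding_limit
    (N : ℕ) (hN : 1 ≤ N)
    (τ : Fin (N + 1) → ℝ) (hτ : StrictMono τ)
    (hτmem : ∀ k, τ k ∈ Set.Ioo (0 : ℝ) 1)
    (horth : ∀ j : ℕ, j ≤ N →
      ∫ ξ in (0:ℝ)..1, ξ ^ j * ∏ k, (ξ - τ k) = 0)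
    (φ : Fin (N + 1) → Polynomial ℝ)
    (hφdeg : ∀ p, (φ p).natDegree ≤ N)
    (hφeval : ∀ p q, (φ p).eval (τ q) = if p = q then 1 else 0)
    (w : Fin (N + 1) → ℝ)
    (hw : ∀ p, w p = ∫ t in (0:ℝ)..1, (φ p).eval t)
    (K : Matrix (Fin (N + 1)) (Fin (N + 1)) ℝ)
    (hK : ∀ p q, K p q = (φ p).eval 0 * (φ q).eval 0 +
      ∫ t in (0:ℝ)..1, (φ p).eval t * (φ q).derivative.eval t)
    (hKdet : IsUnit K.det)
    (A : Matrix (Fin (N + 1)) (Fin (N + 1)) ℝ)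
    (hA : A = K⁻¹ * Matrix.diagonal w)
    (Du Dv : ℕ) (hDu : 1 ≤ Du) (hDv : 1 ≤ Dv)
    (F : (Fin Du → ℝ) → (Fin Dv → ℝ) → ℝ → (Fin Du → ℝ))
    (G : (Fin Du → ℝ) → (Fin Dv → ℝ) → ℝ → (Fin Dv → ℝ))
    (hF : Continuous fun x : (Fin Du → ℝ) × (Fin Dv → ℝ) × ℝ => F x.1 x.2.1 x.2.2)
    (hG : Continuous fun x : (Fin Du → ℝ) × (Fin Dv → ℝ) × ℝ => G x.1 x.2.1 x.2.2)
    (Δt : ℝ) (hΔt : 0 < Δt) (s : Fin (N + 1) → ℝ)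
    (ue : ℝ → Fin Du → ℝ) (ve : ℝ → Fin Dv → ℝ)
    (qe : ℝ → Fin (N + 1) → Fin Du → ℝ) (re : ℝ → Fin (N + 1) → Fin Dv → ℝ)
    (hsys1 : ∀ ε > (0:ℝ), ∀ p,
      qe ε p - Δt • ∑ q, A p q • F (qe ε q) (re ε q) (s q) = ue ε)
    (hsys2 : ∀ ε > (0:ℝ), ∀ p,
      ε • re ε p - Δt • ∑ q, A p q • G (qe ε q) (re ε q) (s q) = ε • ve ε)
    (qh : Fin (N + 1) → Fin Du → ℝ) (rh : Fin (N + 1) → Fin Dv → ℝ)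
    (uu : Fin Du → ℝ) (vv : Fin Dv → ℝ)
    (hq : ∀ p, Tendsto (fun ε => qe ε p) (𝓝[>] (0:ℝ)) (𝓝 (qh p)))
    (hr : ∀ p, Tendsto (fun ε => re ε p) (𝓝[>] (0:ℝ)) (𝓝 (rh p)))
    (hu : Tendsto ue (𝓝[>] (0:ℝ)) (𝓝 uu))
    (hv : Tendsto ve (𝓝[>] (0:ℝ)) (𝓝 vv)) :
    ∀ p, (qh p - Δt • ∑ q, A p q • F (qh q) (rh q) (s q) = uu) ∧
      G (qh p) (rh p) (s p) = 0 := by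
  have hstage : ∀ {D : ℕ} (H : (Fin Du → ℝ) → (Fin Dv → ℝ) → ℝ → (Fin D → ℝ)),
      (Continuous fun x : (Fin Du → ℝ) × (Fin Dv → ℝ) × ℝ => H x.1 x.2.1 x.2.2) → ∀ p,
      Tendsto (fun ε => Δt • ∑ q, A p q • H (qe ε q) (re ε q) (s q)) (𝓝[>] (0:ℝ))
        (𝓝 (Δt • ∑ q, A p q • H (qh q) (rh q) (s q))) := by
    intro D H hH p
    refine (tendsto_finsetSum _ fun q _ => Tendsto.const_smul ?_ _).const_smul _
    exact (hH.tendsto (qh q, rh q, s q)).comp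
      ((hq q).prodMk_nhds ((hr q).prodMk_nhds tendsto_const_nhds))
  have hpos : ∀ᶠ ε in 𝓝[>] (0:ℝ), 0 < ε := eventually_mem_nhdsWithin
  have hε : Tendsto (fun ε : ℝ => ε) (𝓝[>] (0:ℝ)) (𝓝 0) :=
    tendsto_nhdsWithin_of_tendsto_nhds tendsto_id
  have hGsum : ∀ p, ∑ q, A p q • G (qh q) (rh q) (s q) = 0 := by
    intro p
    have hlim := (hε.smul (hr p)).sub (hstage G hG p)
    have heq := tendsto_nhds_unique_of_eventuallyEq hlim (hε.smul hv)
      (hpos.mono fun ε h => hsys2 ε h p)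
    simpa [hΔt.ne'] using heq
  have hKA : K * A = Matrix.diagonal w := by
    rw [hA, Matrix.mul_nonsing_inv_cancel_left _ _ hKdet]
  intro p
  refine ⟨tendsto_nhds_unique_of_eventuallyEq ((hq p).sub (hstage F hF p)) hu
    (hpos.mono fun ε h => hsys1 ε h p), ?_⟩
  funext d
  have hAg : A *ᵥ (fun q => G (qh q) (rh q) (s q) d) = 0 := by
    funext i
    simpa [Matrix.mulVec, dotProduct] using congrFun (hGsum i) d
  have hwg : w p * G (qh p) (rh p) (s p) d = 0 := by
    rw [← Matrix.mulVec_diagonal w (fun q => G (qh q) (rh q) (s q) d) p, ← hKA,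
      ← Matrix.mulVec_mulVec, hAg, Matrix.mulVec_zero, Pi.zero_apply]
  have hwp : 0 < w p := hw p ▸
    integral_lagrange_basis_pos_of_orthogonal hτ.injective hτmem horth (hφdeg p) (hφeval p)
  exact (mul_eq_zero.mp hwg).resolve_left hwp.ne'
end

section
/- Right-endpoint identity for the ε-embedded algebraic subsystem: assume the matrix K is invertible and set A = K⁻¹M. Let D_v ≥ 1 be an integer, ε ∈ ℝ with ε ≠ 0, Δt ∈ ℝ, v_n ∈ ℝ^{D_v}, and let G_0, …, G_N ∈ ℝ^{D_v} be arbitrary vectors. If the vectors r̂_0, …, r̂_N ∈ ℝ^{D_v} satisfy ε·r̂_p = ε·v_n + Δt · Σ_{q=0}^{N} A_{pq} G_q for every 0 ≤ p ≤ N, and v_{n+1} ∈ ℝ^{D_v} is defined by ε·v_{n+1} = ε·v_n + Δt · Σ_{q=0}^{N} w_q G_q, then Σ_{p=0}^{N} φ_p(1) · r̂_p = v_{n+1}. -/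
open MeasureTheory Matrix Polynomial Topology Filter

/-- Polynomials of degree at most `N` that form a Lagrange basis at `N + 1` distinct nodes
sum to one. -/
theorem Polynomial.sum_eq_one_of_eval_eq_ite {R : Type*} [CommRing R] [IsDomain R] {N : ℕ}
    {τ : Fin (N + 1) → R} (hτ : Function.Injective τ) {φ : Fin (N + 1) → R[X]}
    (hdeg : ∀ p, (φ p).natDegree ≤ N)
    (heval : ∀ p q, (φ p).eval (τ q) = if p = q then 1 else 0) :
    ∑ p, φ p = 1 := by
  refine eq_of_natDegree_lt_card_of_eval_eq _ _ hτ (fun q => ?_) ?_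
  · simp [eval_finsetSum, heval]
  · simpa [Nat.lt_succ_iff] using natDegree_sum_le_of_forall_le Finset.univ φ fun p _ => hdeg p

/-- The column sums of the matrix `φ_p(0) φ_q(0) + ∫ φ_p φ_q'` are `φ_q(1)` when the polynomials
`φ_p` sum to one. -/
theorem Polynomial.sum_eval_zero_mul_add_integral_eq_eval_one {ι : Type*} [Fintype ι]
    {φ : ι → ℝ[X]} (hsum : ∑ p, φ p = 1) (f : ℝ[X]) :
    ∑ p, ((φ p).eval 0 * f.eval 0 +
      ∫ t in (0 : ℝ)..1, (φ p).eval t * f.derivative.eval t) = f.eval 1 := by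
  have hsum' : ∀ t : ℝ, ∑ p, (φ p).eval t = 1 := fun t => by
    rw [← eval_finsetSum, hsum, eval_one]
  have hint : ∀ g : ℝ[X], IntervalIntegrable (fun t => g.eval t) volume 0 1 :=
    fun g => g.continuous.intervalIntegrable 0 1
  rw [Finset.sum_add_distrib, ← Finset.sum_mul, hsum', one_mul,
    ← intervalIntegral.integral_finsetSum fun p _ => by
      simpa only [eval_mul] using hint (φ p * f.derivative)]
  simp only [← Finset.sum_mul, hsum', one_mul]
  rw [intervalIntegral.integral_eq_sub_of_hasDerivAt (fun t _ => f.hasDerivAt t)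
    (hint f.derivative)]
  ring

/-- Right-endpoint identity for the ε-embedded algebraic subsystem. -/
theorem aderdg_eps_algebraic_right_endpoint
    (N : ℕ) (hN : 1 ≤ N)
    (τ : Fin (N + 1) → ℝ) (hτ : StrictMono τ)
    (hτmem : ∀ k, τ k ∈ Set.Ioo (0 : ℝ) 1)
    (horth : ∀ j : ℕ, j ≤ N →
      ∫ ξ in (0:ℝ)..1, ξ ^ j * ∏ k, (ξ - τ k) = 0)
    (φ : Fin (N + 1) → Polynomial ℝ)
    (hφdeg : ∀ p, (φ p).natDegree ≤ N)
    (hφeval : ∀ p q, (φ p).eval (τ q) = if p = q then 1 else 0)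
    (w : Fin (N + 1) → ℝ)
    (hw : ∀ p, w p = ∫ t in (0:ℝ)..1, (φ p).eval t)
    (K : Matrix (Fin (N + 1)) (Fin (N + 1)) ℝ)
    (hK : ∀ p q, K p q = (φ p).eval 0 * (φ q).eval 0 +
      ∫ t in (0:ℝ)..1, (φ p).eval t * (φ q).derivative.eval t)
    (hKdet : IsUnit K.det)
    (A : Matrix (Fin (N + 1)) (Fin (N + 1)) ℝ)
    (hA : A = K⁻¹ * Matrix.diagonal w)
    (Dv : ℕ) (hDv : 1 ≤ Dv)
    (ε : ℝ) (hε : ε ≠ 0) (Δt : ℝ)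
    (vn : Fin Dv → ℝ)
    (Gv : Fin (N + 1) → Fin Dv → ℝ)
    (rh : Fin (N + 1) → Fin Dv → ℝ)
    (hrh : ∀ p, ε • rh p = ε • vn + Δt • ∑ q, A p q • Gv q)
    (vn1 : Fin Dv → ℝ)
    (hvn1 : ε • vn1 = ε • vn + Δt • ∑ q, w q • Gv q) :
    ∑ p, (φ p).eval 1 • rh p = vn1 := by
  have hsum : ∑ p, φ p = 1 := sum_eq_one_of_eval_eq_ite hτ.injective hφdeg hφeval
  have hone : ∑ p, (φ p).eval 1 = 1 := by rw [← eval_finsetSum, hsum, eval_one]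
  have hcol : (fun p => (φ p).eval 1) = (1 : Fin (N + 1) → ℝ) ᵥ* K := by
    ext q
    simp only [vecMul, dotProduct, Pi.one_apply, one_mul, hK]
    exact (sum_eval_zero_mul_add_integral_eq_eval_one hsum (φ q)).symm
  have hvec : (fun p => (φ p).eval 1) ᵥ* A = w := by
    rw [hA, hcol, vecMul_vecMul, ← Matrix.mul_assoc, mul_nonsing_inv _ hKdet, Matrix.one_mul]
    ext q
    simp [vecMul_diagonal]
  have hw' : ∀ q, ∑ p, (φ p).eval 1 * A p q = w q := fun q => congrFun hvec q
  refine smul_right_injective _ hε ?_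
  calc ε • ∑ p, (φ p).eval 1 • rh p
      = ∑ p, (φ p).eval 1 • (ε • vn + Δt • ∑ q, A p q • Gv q) := by
        simp only [← hrh]
        simp only [Finset.smul_sum, smul_comm ε]
    _ = ε • vn + Δt • ∑ p, (φ p).eval 1 • ∑ q, A p q • Gv q := by
        simp only [smul_add, Finset.sum_add_distrib, ← Finset.sum_smul, hone, one_smul,
          smul_comm _ Δt, ← Finset.smul_sum]
    _ = ε • vn + Δt • ∑ q, w q • Gv q := by
        simp only [Finset.smul_sum (r := eval _ _), smul_smul (eval _ _)]
        rw [Finset.sum_comm]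
        simp only [← Finset.sum_smul, hw']
    _ = ε • vn1 := hvn1.symm
end
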